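/- (Rota's log-concavity conjecture for realizable arrangements, after Huh and Huh–Katz.) Let 𝒜 = (H_i)_{i∈I} be a finite family of linear hyperplanes H_i = {x ∈ 𝕜^d : l_i(x) = 0} in 𝕜^d over an arbitrary field 𝕜, with each l_i a nonzero linear functional. Write its characteristic polynomial as χ(𝒜;q) = Σ_{ℬ⊆I} (−1)^{|ℬ|} q^{d−r(ℬ)} = Σ_{i≥0} (−1)^i a_i q^{d−i}, i.e., a_i := (−1)^i · (the coefficient of q^{d−i} in χ(𝒜;q)). Then the coefficients alternate in sign and are log-concave: a_i ≥ 0 for all i ≥ 0, and a_{i−1}·a_{i+1} ≤ a_i² for all i ≥ 1. (In particular the sequence a_0, a_1, a_2, … is unimodal.) -/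

import Mathlib

open Polynomial
open scoped BigOperators

section Hodge
open Matrix

variable {n : Type} [Fintype n] [DecidableEq n]

theorem dotProduct_mulVec_nonpos_of_eigenvectors {N : Matrix n n ℝ} (hN : N.IsSymm) (x : n → ℝ)
    (h : ∀ (t : ℝ) (v : n → ℝ), 0 < t → N *ᵥ v = t • v → v ⬝ᵥ x = 0) :
    x ⬝ᵥ N *ᵥ x ≤ 0 := by
  have hH : N.IsHermitian := by
    rw [Matrix.IsHermitian, Matrix.conjTranspose_eq_transpose_of_trivial]
    exact hN
  let e := hH.eigenvectorBasis
  have h1 : x ⬝ᵥ N *ᵥ x = ∑ k, inner ℝ (WithLp.toLp 2 x) (e k)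
      * inner ℝ (e k) (WithLp.toLp 2 (N *ᵥ x)) := by
    rw [e.sum_inner_mul_inner, EuclideanSpace.inner_eq_star_dotProduct, dotProduct_comm]
    simp
  rw [h1]
  apply Finset.sum_nonpos
  intro k _
  have h2 : N *ᵥ (e k).ofLp = hH.eigenvalues k • (e k).ofLp := hH.mulVec_eigenvectorBasis k
  have h3 : inner ℝ (WithLp.toLp 2 x) (e k) = (e k).ofLp ⬝ᵥ x := by
    rw [EuclideanSpace.inner_eq_star_dotProduct]
    simp
  have h4 : inner ℝ (e k) (WithLp.toLp 2 (N *ᵥ x)) = hH.eigenvalues k * ((e k).ofLp ⬝ᵥ x) := by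
    rw [EuclideanSpace.inner_eq_star_dotProduct]
    simp only [star_trivial]
    rw [dotProduct_comm, dotProduct_mulVec, ← mulVec_transpose, hN, h2, smul_dotProduct,
      smul_eq_mul]
  rw [h3, h4]
  by_cases ht : 0 < hH.eigenvalues k
  · rw [h _ _ ht h2]
    simp
  · nlinarith [sq_nonneg ((e k).ofLp ⬝ᵥ x)]

omit [DecidableEq n] in
theorem sum_mul_sub_sq_eq {M : Matrix n n ℝ} (hM : M.IsSymm) {c : n → ℝ} (hc : ∀ i, c i ≠ 0)
    (y : n → ℝ) :
    ∑ i, ∑ j, M i j * c i * c j * (y i / c i - y j / c j) ^ 2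
      = 2 * (∑ i, y i ^ 2 * (M *ᵥ c) i / c i - y ⬝ᵥ M *ᵥ y) := by
  have h1 : ∀ i j, M i j * c i * c j * (y i / c i - y j / c j) ^ 2
      = y i ^ 2 * (M i j * c j) / c i + y j ^ 2 * (M j i * c i) / c j
        - 2 * (y i * (M i j * y j)) := by
    intro i j
    have := hc i
    have := hc j
    rw [hM.apply i j]
    field_simp
    ring
  have h2 : ∑ i, ∑ j, y i ^ 2 * (M i j * c j) / c i = ∑ i, y i ^ 2 * (M *ᵥ c) i / c i := by
    simp only [mulVec, dotProduct, Finset.mul_sum, Finset.sum_div]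
  have h3 : ∑ i, ∑ j, y j ^ 2 * (M j i * c i) / c j = ∑ i, y i ^ 2 * (M *ᵥ c) i / c i := by
    rw [Finset.sum_comm, h2]
  have h4 : ∑ i, ∑ j, 2 * (y i * (M i j * y j)) = 2 * (y ⬝ᵥ M *ᵥ y) := by
    simp only [mulVec, dotProduct, Finset.mul_sum]
  simp only [h1, Finset.sum_sub_distrib, Finset.sum_add_distrib, h2, h3, h4]
  ring

/-- A connected symmetric matrix with nonnegative off-diagonal entries which satisfies the
quadratic inequality `hloc` has at most one positive eigenvalue. -/
theorem hodge_index_of_quadratic {M : Matrix n n ℝ} (hM : M.IsSymm)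
    (hpos : ∀ i j, i ≠ j → 0 ≤ M i j)
    (hconn : ∀ f : n → ℝ, (∀ i j, i ≠ j → 0 < M i j → f i = f j) → ∀ i j, f i = f j)
    {c : n → ℝ} (hc : ∀ i, 0 < c i) (hMc : ∀ i, 0 < (M *ᵥ c) i)
    (hloc : ∀ y : n → ℝ, y ⬝ᵥ M *ᵥ y ≤ ∑ i, c i * (M *ᵥ y) i ^ 2 / (M *ᵥ c) i)
    (y : n → ℝ) : (c ⬝ᵥ M *ᵥ c) * (y ⬝ᵥ M *ᵥ y) ≤ (c ⬝ᵥ M *ᵥ y) ^ 2 := by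
  rcases isEmpty_or_nonempty n with hn | hn
  · simp [dotProduct]
  have hcMc : 0 < c ⬝ᵥ M *ᵥ c :=
    Finset.sum_pos (fun i _ => mul_pos (hc i) (hMc i)) Finset.univ_nonempty
  have hsym : ∀ u v : n → ℝ, u ⬝ᵥ M *ᵥ v = v ⬝ᵥ M *ᵥ u := by
    intro u v
    rw [dotProduct_mulVec, ← mulVec_transpose, hM, dotProduct_comm]
  have key : ∀ w : n → ℝ, c ⬝ᵥ M *ᵥ w = 0 → w ⬝ᵥ M *ᵥ w ≤ 0 := by
    intro w hw
    let s : n → ℝ := fun i => Real.sqrt ((M *ᵥ c) i / c i)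
    have hs : ∀ i, 0 < s i := fun i => Real.sqrt_pos.2 (div_pos (hMc i) (hc i))
    have hs2 : ∀ i, s i ^ 2 = (M *ᵥ c) i / c i := fun i =>
      Real.sq_sqrt (div_pos (hMc i) (hc i)).le
    let N : Matrix n n ℝ := fun i j => M i j / (s i * s j)
    have hN : N.IsSymm := by
      ext i j
      change M j i / (s j * s i) = M i j / (s i * s j)
      rw [hM.apply, mul_comm (s j)]
    have hNM : ∀ v : n → ℝ, ∀ i, (N *ᵥ fun j => s j * v j) i = (M *ᵥ v) i / s i := by
      intro v i
      simp only [mulVec, dotProduct, Finset.sum_div]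
      refine Finset.sum_congr rfl fun j _ => ?_
      change M i j / (s i * s j) * (s j * v j) = _
      have := (hs i).ne'
      have := (hs j).ne'
      field_simp
    have hww : w ⬝ᵥ M *ᵥ w = (fun i => s i * w i) ⬝ᵥ N *ᵥ (fun i => s i * w i) := by
      simp only [dotProduct, hNM]
      refine Finset.sum_congr rfl fun i _ => ?_
      have := (hs i).ne'
      field_simp
    rw [hww]
    apply dotProduct_mulVec_nonpos_of_eigenvectors hN
    intro t v ht hv
    let u : n → ℝ := fun i => v i / s i
    have hvu : v = fun i => s i * u i := by
      funext i
      have := (hs i).ne'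
      simp only [u]
      field_simp
    have hMu : ∀ i, (M *ᵥ u) i = t * (s i ^ 2 * u i) := by
      intro i
      have h1 := congrFun hv i
      rw [hvu, hNM u i, div_eq_iff (hs i).ne'] at h1
      rw [h1, Pi.smul_apply, smul_eq_mul]
      ring
    have huMu : u ⬝ᵥ M *ᵥ u = t * ∑ i, s i ^ 2 * u i ^ 2 := by
      simp only [dotProduct, hMu, Finset.mul_sum]
      exact Finset.sum_congr rfl fun i _ => by ring
    have hnorm : ∀ i, u i ^ 2 * (M *ᵥ c) i / c i = s i ^ 2 * u i ^ 2 := by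
      intro i
      rw [hs2]
      ring
    have hl : u ⬝ᵥ M *ᵥ u ≤ t ^ 2 * ∑ i, s i ^ 2 * u i ^ 2 := by
      refine (hloc u).trans_eq ?_
      rw [Finset.mul_sum]
      refine Finset.sum_congr rfl fun i _ => ?_
      rw [hMu, hs2]
      have := (hc i).ne'
      have := (hMc i).ne'
      field_simp
    have hq0 : 0 ≤ ∑ i, s i ^ 2 * u i ^ 2 := Finset.sum_nonneg fun i _ => by positivity
    have hid := sum_mul_sub_sq_eq hM (fun i => (hc i).ne') u
    simp only [hnorm] at hid
    have hterm : ∀ i j, 0 ≤ M i j * c i * c j * (u i / c i - u j / c j) ^ 2 := by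
      intro i j
      by_cases hij : i = j
      · simp [hij]
      · exact mul_nonneg (mul_nonneg (mul_nonneg (hpos i j hij) (hc i).le) (hc j).le)
          (sq_nonneg _)
    have hzero : ∑ i, ∑ j, M i j * c i * c j * (u i / c i - u j / c j) ^ 2 ≤ 0 := by
      rw [hid]
      rw [huMu] at hl ⊢
      nlinarith
    have hconst : ∀ i j, u i / c i = u j / c j := by
      apply hconn
      intro i j _ hij
      have h1 := (Finset.sum_eq_zero_iff_of_nonneg fun i _ =>
        Finset.sum_nonneg fun j _ => hterm i j).1
        (le_antisymm hzero (Finset.sum_nonneg fun i _ => Finset.sum_nonneg fun j _ => hterm i j))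
        i (Finset.mem_univ _)
      have h2 := (Finset.sum_eq_zero_iff_of_nonneg fun j _ => hterm i j).1 h1 j
        (Finset.mem_univ _)
      have h3 : M i j * c i * c j ≠ 0 := (mul_pos (mul_pos hij (hc i)) (hc j)).ne'
      have h4 := (mul_eq_zero.1 h2).resolve_left h3
      exact sub_eq_zero.1 (pow_eq_zero_iff (two_ne_zero)|>.1 h4)
    obtain ⟨i0⟩ := hn
    have hu : ∀ i, u i = u i0 / c i0 * c i := by
      intro i
      rw [← hconst i i0, div_mul_cancel₀ _ (hc i).ne']
    rw [hvu]
    have h5 : w ⬝ᵥ M *ᵥ c = 0 := by rw [hsym, hw]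
    calc (fun i => s i * u i) ⬝ᵥ (fun i => s i * w i)
        = u i0 / c i0 * (w ⬝ᵥ M *ᵥ c) := by
          simp only [dotProduct, Finset.mul_sum]
          refine Finset.sum_congr rfl fun i _ => ?_
          have h6 : s i * u i * (s i * w i) = s i ^ 2 * u i * w i := by ring
          rw [h6, hs2, hu i]
          have := (hc i).ne'
          field_simp
      _ = 0 := by rw [h5, mul_zero]
  have h1 := key (y - ((c ⬝ᵥ M *ᵥ y) / (c ⬝ᵥ M *ᵥ c)) • c) (by
    rw [mulVec_sub, mulVec_smul, dotProduct_sub, dotProduct_smul, smul_eq_mul,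
      div_mul_cancel₀ _ hcMc.ne', sub_self])
  rw [mulVec_sub, mulVec_smul, dotProduct_sub, sub_dotProduct, sub_dotProduct, smul_dotProduct,
    smul_dotProduct, dotProduct_smul, dotProduct_smul, hsym y c] at h1
  simp only [smul_eq_mul] at h1
  generalize c ⬝ᵥ M *ᵥ y = a at *
  generalize c ⬝ᵥ M *ᵥ c = b at *
  generalize y ⬝ᵥ M *ᵥ y = d at *
  have h2 : d - a ^ 2 / b ≤ 0 := by
    refine le_trans (le_of_eq ?_) h1
    field_simp
    ring
  have h3 : d ≤ a ^ 2 / b := by linarith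
  rw [le_div_iff₀ hcMc] at h3
  linarith

end Hodge

/-- An axiomatization of the lattice of flats of a matroid on the ground set `E`. -/
structure FlatLattice (E L : Type) [PartialOrder L] where
  mem : E → L → Prop
  rk : L → ℕ
  le_iff : ∀ F G : L, F ≤ G ↔ ∀ i, mem i F → mem i G
  rk_lt : ∀ {F G : L}, F < G → rk F < rk G
  adjoin : ∀ (F : L) (i : E), ¬ mem i F →
    ∃ H, F < H ∧ mem i H ∧ rk H = rk F + 1 ∧ ∀ K, F ≤ K → mem i K → H ≤ K

namespace FlatLattice

variable {E L : Type} [PartialOrder L] (A : FlatLattice E L)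

theorem mem_mono {F G : L} (h : F ≤ G) {i : E} (hi : A.mem i F) : A.mem i G :=
  (A.le_iff F G).1 h i hi

theorem exists_sep {F G : L} (h : F < G) : ∃ i, A.mem i G ∧ ¬ A.mem i F := by
  by_contra! hc
  exact h.not_ge ((A.le_iff G F).2 hc)

open Classical in
/-- The indicator function of `i` belonging to a flat. -/
noncomputable def ind (R : Type) [CommRing R] (i : E) (H : L) : R := if A.mem i H then 1 else 0

theorem ind_of_mem {R : Type} [CommRing R] {i : E} {H : L} (h : A.mem i H) :
    A.ind R i H = 1 := if_pos h

theorem ind_of_notMem {R : Type} [CommRing R] {i : E} {H : L} (h : ¬ A.mem i H) :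
    A.ind R i H = 0 := if_neg h

/-- The dimension of the interval `[F, G]`: its rank minus one. -/
def deg (F G : L) : ℝ := (A.rk G : ℝ) - A.rk F - 1

section Volume

variable [Nonempty E]

/-- An element of `G` outside `F`. -/
noncomputable def sep (F G : L) : E := Classical.epsilon fun i => A.mem i G ∧ ¬ A.mem i F

theorem sep_mem {F G : L} (h : F < G) : A.mem (A.sep F G) G :=
  (Classical.epsilon_spec (A.exists_sep h)).1

theorem sep_notMem {F G : L} (h : F < G) : ¬ A.mem (A.sep F G) F :=
  (Classical.epsilon_spec (A.exists_sep h)).2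

variable [Fintype L]

open Classical in
/-- The volume polynomial of the interval `[F, G]`, set to be zero unless `F < G`. -/
noncomputable def vol (F G : L) : MvPolynomial L ℝ :=
  if F < G then
    if A.rk G ≤ A.rk F + 1 then 1 else
      MvPolynomial.C (A.deg F G)⁻¹ * ∑ H : {H : L // F < H ∧ H < G},
        (MvPolynomial.X H.1 - A.ind _ (A.sep F G) H.1 * MvPolynomial.X G
          - (1 - A.ind _ (A.sep F G) H.1) * MvPolynomial.X F) * (vol F H.1 * vol H.1 G)
  else 0
termination_by A.rk G - A.rk F
decreasing_by
  · have h1 := A.rk_lt H.2.1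
    have h2 := A.rk_lt H.2.2
    omega
  · have h1 := A.rk_lt H.2.1
    have h2 := A.rk_lt H.2.2
    omega

theorem vol_of_not_lt {F G : L} (h : ¬ F < G) : A.vol F G = 0 := by
  rw [vol, if_neg h]

theorem vol_of_rk_le {F G : L} (h : F < G) (h' : A.rk G ≤ A.rk F + 1) : A.vol F G = 1 := by
  rw [vol, if_pos h, if_pos h']

/-- The directional derivative of the volume polynomial, normalized at `i`. -/
noncomputable def dvolAt (i : E) (F G : L) (y : L → MvPolynomial L ℝ) : MvPolynomial L ℝ :=
  ∑ H, (y H - A.ind _ i H * y G - (1 - A.ind _ i H) * y F) * (A.vol F H * A.vol H G)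

/-- The directional derivative of the volume polynomial in the direction `y`. -/
noncomputable def dvol (F G : L) (y : L → MvPolynomial L ℝ) : MvPolynomial L ℝ :=
  A.dvolAt (A.sep F G) F G y

/-- The sum of the products `vol F H * vol H G` over the flats `H` containing `i`. -/
noncomputable def starSum (i : E) (F G : L) : MvPolynomial L ℝ :=
  ∑ H, A.ind _ i H * (A.vol F H * A.vol H G)

theorem vol_mul_vol_eq_zero {F H G : L} (h : ¬ (F < H ∧ H < G)) :
    A.vol F H * A.vol H G = 0 := by
  by_cases h1 : F < H
  · rw [A.vol_of_not_lt (F := H) (fun h2 => h ⟨h1, h2⟩), mul_zero]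
  · rw [A.vol_of_not_lt h1, zero_mul]

theorem vol_mul_vol_eq_zero_of_rk {F G : L} (h' : A.rk G ≤ A.rk F + 1) (H : L) :
    A.vol F H * A.vol H G = 0 := by
  apply vol_mul_vol_eq_zero
  rintro ⟨h1, h2⟩
  have := A.rk_lt h1
  have := A.rk_lt h2
  omega

theorem deg_mul_vol {F G : L} (h : F < G) :
    MvPolynomial.C (A.deg F G) * A.vol F G = A.dvol F G MvPolynomial.X := by
  classical
  by_cases h' : A.rk G ≤ A.rk F + 1
  · have h0 : A.deg F G = 0 := by
      have := A.rk_lt h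
      have h2 : A.rk G = A.rk F + 1 := by omega
      simp [deg, h2]
    rw [h0, map_zero, zero_mul, dvol, dvolAt, Finset.sum_eq_zero]
    intro H _
    rw [A.vol_mul_vol_eq_zero_of_rk h', mul_zero]
  · have h0 : A.deg F G ≠ 0 := by
      have h2 : A.rk F + 1 < A.rk G := by omega
      have h3 : (A.rk F : ℝ) + 1 < A.rk G := by exact_mod_cast h2
      unfold deg
      linarith
    rw [vol, if_pos h, if_neg h', ← mul_assoc, ← map_mul, mul_inv_cancel₀ h0, map_one, one_mul,
      dvol, dvolAt, ← Finset.sum_subset (Finset.filter_subset (fun H => F < H ∧ H < G) Finset.univ)]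
    · exact (Finset.sum_subtype _ (by simp) fun H => (MvPolynomial.X H
        - A.ind _ (A.sep F G) H * MvPolynomial.X G
        - (1 - A.ind _ (A.sep F G) H) * MvPolynomial.X F) * (A.vol F H * A.vol H G)).symm
    · intro H _ hH
      rw [A.vol_mul_vol_eq_zero (by simpa using hH), mul_zero]

theorem dvolAt_eq (i : E) (F G : L) (y : L → MvPolynomial L ℝ) :
    A.dvolAt i F G y = ∑ H, y H * (A.vol F H * A.vol H G) - y G * A.starSum i F G
      - y F * (∑ H, A.vol F H * A.vol H G - A.starSum i F G) := by
  simp only [dvolAt, starSum, Finset.mul_sum, ← Finset.sum_sub_distrib]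
  apply Finset.sum_congr rfl
  intro H _
  ring

/-- The star sums of the interval `[F, G]` do not depend on the element. -/
def Indep (F G : L) : Prop :=
  ∀ i j, A.mem i G → ¬ A.mem i F → A.mem j G → ¬ A.mem j F → A.starSum i F G = A.starSum j F G

variable {A} in
theorem Indep.dvol_eq {F G : L} (hI : A.Indep F G) {i : E} (hi : A.mem i G) (hi' : ¬ A.mem i F)
    (h : F < G) (y : L → MvPolynomial L ℝ) : A.dvol F G y = A.dvolAt i F G y := by
  rw [dvol, dvolAt_eq, dvolAt_eq, hI i _ hi hi' (A.sep_mem h) (A.sep_notMem h)]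

theorem dvol_sub (F G : L) (y z : L → MvPolynomial L ℝ) :
    A.dvol F G (fun H => y H - z H) = A.dvol F G y - A.dvol F G z := by
  simp only [dvol, dvolAt, ← Finset.sum_sub_distrib]
  apply Finset.sum_congr rfl
  intro H _
  ring

theorem dvol_mul_right (F G : L) (y : L → MvPolynomial L ℝ) (c : MvPolynomial L ℝ) :
    A.dvol F G (fun H => y H * c) = A.dvol F G y * c := by
  simp only [dvol, dvolAt, Finset.sum_mul]
  apply Finset.sum_congr rfl
  intro H _
  ring

theorem dvol_of_not_lt {F G : L} (h : ¬ F < G) (y : L → MvPolynomial L ℝ) :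
    A.dvol F G y = 0 := by
  rw [dvol, dvolAt, Finset.sum_eq_zero]
  intro H _
  rw [A.vol_mul_vol_eq_zero fun h' => h (h'.1.trans h'.2), mul_zero]

theorem dvol_const (F G : L) (c : MvPolynomial L ℝ) : A.dvol F G (fun _ => c) = 0 := by
  rw [dvol, dvolAt, Finset.sum_eq_zero]
  intro H _
  ring

variable {A} in
theorem Indep.dvol_ind {F G : L} (hI : A.Indep F G) (i : E) :
    A.dvol F G (A.ind _ i) = 0 := by
  by_cases h : F < G
  swap
  · exact A.dvol_of_not_lt h _
  by_cases hi : A.mem i F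
  · rw [dvol, dvolAt, Finset.sum_eq_zero]
    intro H _
    by_cases hH : F < H ∧ H < G
    · rw [A.ind_of_mem hi, A.ind_of_mem (A.mem_mono hH.1.le hi), A.ind_of_mem (A.mem_mono h.le hi)]
      ring
    · rw [A.vol_mul_vol_eq_zero hH, mul_zero]
  by_cases hi' : A.mem i G
  · rw [hI.dvol_eq hi' hi h, dvolAt, Finset.sum_eq_zero]
    intro H _
    rw [A.ind_of_mem hi', A.ind_of_notMem hi]
    ring
  · rw [dvol, dvolAt, Finset.sum_eq_zero]
    intro H _
    by_cases hH : F < H ∧ H < G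
    · rw [A.ind_of_notMem hi, A.ind_of_notMem fun hm => hi' (A.mem_mono hH.2.le hm),
        A.ind_of_notMem hi']
      ring
    · rw [A.vol_mul_vol_eq_zero hH, mul_zero]

variable {A} in
theorem Indep.dvol_normalize {F G : L} (hI : A.Indep F G) (y : L → MvPolynomial L ℝ) (i : E)
    (a c : MvPolynomial L ℝ) :
    A.dvol F G (fun H => y H - (a + A.ind _ i H * c)) = A.dvol F G y := by
  have h : (fun H => a + A.ind (MvPolynomial L ℝ) i H * c)
      = fun H => a - A.ind (MvPolynomial L ℝ) i H * (-c) := by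
    funext H
    ring
  rw [dvol_sub, h, dvol_sub, dvol_const, dvol_mul_right, hI.dvol_ind]
  ring

theorem star_dvol_eq {F G : L} (hFG : F < G)
    (ih : ∀ F' G', A.rk G' - A.rk F' < A.rk G - A.rk F → A.Indep F' G')
    {i : E} (hi : A.mem i G) (hi' : ¬ A.mem i F) (y : L → MvPolynomial L ℝ)
    (hF : y F = 0) (hG : y G = 0) :
    ∑ H, A.ind _ i H * (A.dvol F H y * A.vol H G + A.vol F H * A.dvol H G y)
      = ∑ K, y K * A.vol F K * A.starSum (A.sep K G) K G := by
  have rkFG := A.rk_lt hFG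
  have hterm : ∀ H, A.ind _ i H * (A.dvol F H y * A.vol H G + A.vol F H * A.dvol H G y)
      = ∑ K, A.ind _ i H * y K * A.vol F K * A.vol K H * A.vol H G
        - ∑ K, A.ind _ i K * y H * A.vol F K * A.vol K H * A.vol H G
        + ∑ K, A.ind _ i H * y K * A.vol F H * A.vol H K * A.vol K G
        - A.ind _ i H * y H * A.vol F H * (∑ K, A.vol H K * A.vol K G
            - A.starSum (A.sep H G) H G) := by
    intro H
    by_cases hH : F < H ∧ H < G
    swap
    · have h0 := A.vol_mul_vol_eq_zero hH
      by_cases h1 : F < H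
      · have h2 : ¬ H < G := fun h2 => hH ⟨h1, h2⟩
        have h3 : ∀ K, A.vol H K * A.vol K G = 0 := fun K =>
          A.vol_mul_vol_eq_zero fun h => h2 (h.1.trans h.2)
        simp [A.vol_of_not_lt h2, A.dvol_of_not_lt h2, starSum, h3, mul_assoc]
      · have h3 : ∀ K, A.vol F K * A.vol K H = 0 := fun K =>
          A.vol_mul_vol_eq_zero fun h => h1 (h.1.trans h.2)
        have h4 : ∀ K, A.vol F K * (A.vol K H * A.vol H G) = 0 := fun K => by
          rw [← mul_assoc, h3, zero_mul]
        simp [A.vol_of_not_lt h1, A.dvol_of_not_lt h1, mul_assoc, h4]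
    have r1 := A.rk_lt hH.1
    have r2 := A.rk_lt hH.2
    by_cases hiH : A.mem i H
    · rw [(ih F H (by omega)).dvol_eq hiH hi' hH.1, dvol, dvolAt_eq, dvolAt_eq, hF, hG,
        A.ind_of_mem hiH]
      simp only [starSum, Finset.mul_sum, Finset.sum_mul, ← Finset.sum_sub_distrib,
        ← Finset.sum_add_distrib]
      refine Finset.sum_congr rfl fun K _ => ?_
      ring
    · have h3 : ∀ K, A.ind (MvPolynomial L ℝ) i K * A.vol K H = 0 := by
        intro K
        by_cases hK : K < H
        · rw [A.ind_of_notMem fun hm => hiH (A.mem_mono hK.le hm), zero_mul]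
        · rw [A.vol_of_not_lt hK, mul_zero]
      have h4 : ∑ K, A.ind (MvPolynomial L ℝ) i K * y H * A.vol F K * A.vol K H * A.vol H G
          = 0 := by
        apply Finset.sum_eq_zero
        intro K _
        linear_combination (y H * A.vol F K * A.vol H G) * h3 K
      rw [h4, A.ind_of_notMem hiH]
      simp
  have hleft : ∑ H, ∑ K, A.ind (MvPolynomial L ℝ) i K * y H * A.vol F K * A.vol K H * A.vol H G
      = ∑ H, ∑ K, A.ind (MvPolynomial L ℝ) i H * y K * A.vol F H * A.vol H K * A.vol K G :=
    Finset.sum_comm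
  have hright : ∑ H, ∑ K, A.ind (MvPolynomial L ℝ) i H * y K * A.vol F K * A.vol K H * A.vol H G
      = ∑ K, y K * A.vol F K * A.starSum i K G := by
    rw [Finset.sum_comm]
    simp only [starSum, Finset.mul_sum]
    refine Finset.sum_congr rfl fun H _ => Finset.sum_congr rfl fun K _ => ?_
    ring
  simp only [hterm, Finset.sum_sub_distrib, Finset.sum_add_distrib]
  rw [hleft, hright, sub_add_cancel, ← Finset.sum_sub_distrib]
  apply Finset.sum_congr rfl
  intro K _
  by_cases hK : F < K ∧ K < G
  swap
  · by_cases h1 : F < K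
    · have h2 : ¬ K < G := fun h2 => hK ⟨h1, h2⟩
      have h3 : ∀ H, A.vol K H * A.vol H G = 0 := fun H =>
        A.vol_mul_vol_eq_zero fun h => h2 (h.1.trans h.2)
      simp [starSum, h3]
    · simp [A.vol_of_not_lt h1]
  have r1 := A.rk_lt hK.1
  have r2 := A.rk_lt hK.2
  by_cases hiK : A.mem i K
  · have h5 : A.starSum i K G = ∑ H, A.vol K H * A.vol H G := by
      apply Finset.sum_congr rfl
      intro H _
      by_cases hKH : K < H
      · rw [A.ind_of_mem (A.mem_mono hKH.le hiK), one_mul]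
      · rw [A.vol_of_not_lt hKH]; ring
    rw [h5, A.ind_of_mem hiK]
    ring
  · rw [A.ind_of_notMem hiK,
      ih K G (by omega) i _ hi hiK (A.sep_mem hK.2) (A.sep_notMem hK.2)]
    ring

theorem rk_two_sum (F G : L) (h : F < G) (h2 : A.rk G = A.rk F + 2) {i : E} (hi : A.mem i G)
    (hi' : ¬ A.mem i F) : A.starSum i F G = 1 := by
  obtain ⟨H, hFH, hiH, hrk, hmin⟩ := A.adjoin F i hi'
  have hHG : H < G := by
    refine lt_of_le_of_ne (hmin G h.le hi) ?_
    rintro rfl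
    omega
  rw [starSum, Finset.sum_eq_single H]
  · rw [A.ind_of_mem hiH, A.vol_of_rk_le hFH (by omega), A.vol_of_rk_le hHG (by omega)]
    ring
  · intro K _ hK
    by_cases hFK : F < K ∧ K < G
    · rw [A.ind_of_notMem, zero_mul]
      intro hiK
      have h3 := lt_of_le_of_ne (hmin K hFK.1.le hiK) hK.symm
      have := A.rk_lt h3
      have := A.rk_lt hFK.2
      omega
    · rw [A.vol_mul_vol_eq_zero hFK, mul_zero]
  · simp

theorem indep (F G : L) : A.Indep F G := by
  induction hn : A.rk G - A.rk F using Nat.strong_induction_on generalizing F G with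
  | _ n IH =>
    subst hn
    have ih : ∀ F' G', A.rk G' - A.rk F' < A.rk G - A.rk F → A.Indep F' G' :=
      fun F' G' h => IH _ h F' G' rfl
    intro i j hi hi' hj hj'
    by_cases hFG : F < G
    swap
    · simp [starSum, fun H => A.vol_mul_vol_eq_zero (F := F) (G := G) (H := H)
        fun h => hFG (h.1.trans h.2)]
    have rkFG := A.rk_lt hFG
    by_cases h1 : A.rk G ≤ A.rk F + 1
    · simp [starSum, A.vol_mul_vol_eq_zero_of_rk h1]
    by_cases h2 : A.rk G = A.rk F + 2
    · rw [A.rk_two_sum F G hFG h2 hi hi', A.rk_two_sum F G hFG h2 hj hj']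
    have key : ∀ k, A.mem k G → ¬ A.mem k F →
        MvPolynomial.C (A.deg F G - 1) * A.starSum k F G
          = ∑ K, (MvPolynomial.X K - (MvPolynomial.X F + A.ind _ i K *
              (MvPolynomial.X G - MvPolynomial.X F))) * A.vol F K
              * A.starSum (A.sep K G) K G := by
      intro k hk hk'
      rw [← A.star_dvol_eq hFG ih hk hk' (fun K => MvPolynomial.X K -
        (MvPolynomial.X F + A.ind _ i K * (MvPolynomial.X G - MvPolynomial.X F)))
        (by rw [A.ind_of_notMem hi']; ring) (by rw [A.ind_of_mem hi]; ring)]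
      rw [starSum, Finset.mul_sum]
      apply Finset.sum_congr rfl
      intro H _
      by_cases hH : F < H ∧ H < G
      swap
      · by_cases h1 : F < H
        · have h2 : ¬ H < G := fun h2 => hH ⟨h1, h2⟩
          simp [A.vol_of_not_lt h2, A.dvol_of_not_lt h2]
        · simp [A.vol_of_not_lt h1, A.dvol_of_not_lt h1]
      have r1 := A.rk_lt hH.1
      have r2 := A.rk_lt hH.2
      rw [(ih F H (by omega)).dvol_normalize, (ih H G (by omega)).dvol_normalize,
        ← A.deg_mul_vol hH.1, ← A.deg_mul_vol hH.2]
      have : A.deg F G - 1 = A.deg F H + A.deg H G := by unfold deg; ring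
      rw [this, map_add]
      ring
    have h0 : A.deg F G - 1 ≠ 0 := by
      have h2 : A.rk F + 2 < A.rk G := by omega
      have h3 : (A.rk F : ℝ) + 2 < A.rk G := by exact_mod_cast h2
      unfold deg
      linarith
    have hC : (MvPolynomial.C (A.deg F G - 1) : MvPolynomial L ℝ) ≠ 0 := by
      rwa [Ne, MvPolynomial.C_eq_zero]
    exact mul_left_cancel₀ hC ((key i hi hi').trans (key j hj hj').symm)

end Volume

end FlatLattice

namespace FlatLattice

variable {E L : Type} [PartialOrder L] (A : FlatLattice E L)
theorem deg_eq_zero {F G : L} (h : F < G) (h' : A.rk G ≤ A.rk F + 1) : A.deg F G = 0 := by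
  have := A.rk_lt h
  have h2 : A.rk G = A.rk F + 1 := by omega
  simp [deg, h2]

theorem one_le_deg {F G : L} (h' : ¬ A.rk G ≤ A.rk F + 1) : 1 ≤ A.deg F G := by
  have h2 : A.rk F + 2 ≤ A.rk G := by omega
  have h3 : (A.rk F : ℝ) + 2 ≤ A.rk G := by exact_mod_cast h2
  unfold deg
  linarith

theorem derivation_ind (δ : Derivation ℝ (MvPolynomial L ℝ) (MvPolynomial L ℝ)) (i : E) (H : L) :
    δ (A.ind _ i H) = 0 := by
  by_cases h : A.mem i H
  · rw [A.ind_of_mem h, Derivation.map_one_eq_zero]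
  · rw [A.ind_of_notMem h, map_zero]

theorem derivation_coeff (δ : Derivation ℝ (MvPolynomial L ℝ) (MvPolynomial L ℝ)) (i : E)
    (a b c : MvPolynomial L ℝ) (H : L) :
    δ (a - A.ind _ i H * b - (1 - A.ind _ i H) * c)
      = δ a - A.ind _ i H * δ b - (1 - A.ind _ i H) * δ c := by
  simp [Derivation.leibniz, derivation_ind, Derivation.map_one_eq_zero]

section Derivation
variable [Nonempty E] [Fintype L]

open Classical in
/-- The matrix of second partial derivatives of the volume polynomial. -/
noncomputable def hess (F G H K : L) : MvPolynomial L ℝ :=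
  A.vol F K * A.vol K H * A.vol H G + A.vol F H * A.vol H K * A.vol K G -
    (if H = K then 1 else 0) * (A.starSum (A.sep F H) F H * A.vol H G
      + A.vol F H * (∑ J, A.vol H J * A.vol J G - A.starSum (A.sep H G) H G))

theorem hess_symm (F G H K : L) : A.hess F G H K = A.hess F G K H := by
  by_cases h : H = K
  · rw [h]
  · rw [hess, hess, if_neg h, if_neg (Ne.symm h)]
    ring

open Classical in
theorem sum_hess_mul (F G H : L) (y : L → MvPolynomial L ℝ) (hF : y F = 0) (hG : y G = 0) :
    ∑ K, A.hess F G H K * y K = A.dvol F H y * A.vol H G + A.vol F H * A.dvol H G y := by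
  rw [dvol, dvol, dvolAt_eq, dvolAt_eq, hF, hG]
  have h0 : ∀ D : MvPolynomial L ℝ, ∑ K, (if H = K then 1 else 0) * D * y K = D * y H := by
    intro D
    simp
  simp only [hess, sub_mul _ _ (y _), add_mul _ _ (y _), Finset.sum_sub_distrib,
    Finset.sum_add_distrib, h0]
  have h1 : ∑ K, A.vol F K * A.vol K H * A.vol H G * y K
      = (∑ K, y K * (A.vol F K * A.vol K H)) * A.vol H G := by
    rw [Finset.sum_mul]
    exact Finset.sum_congr rfl fun K _ => by ring
  have h2 : ∑ K, A.vol F H * A.vol H K * A.vol K G * y K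
      = A.vol F H * ∑ K, y K * (A.vol H K * A.vol K G) := by
    rw [Finset.mul_sum]
    exact Finset.sum_congr rfl fun K _ => by ring
  rw [h1, h2]
  ring

/-- The second directional derivative of the volume polynomial in the directions `z` and `y`. -/
noncomputable def ddvol (F G : L) (z y : L → MvPolynomial L ℝ) : MvPolynomial L ℝ :=
  ∑ H, (z H - A.ind _ (A.sep F G) H * z G - (1 - A.ind _ (A.sep F G) H) * z F) *
    (A.dvol F H y * A.vol H G + A.vol F H * A.dvol H G y)

theorem ddvol_symm {F G : L} (h : F < G) (z y : L → MvPolynomial L ℝ) :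
    A.ddvol F G z y = A.ddvol F G y z := by
  have key : ∀ z y : L → MvPolynomial L ℝ, A.ddvol F G z y = ∑ H, ∑ K,
      (z H - (z F + A.ind _ (A.sep F G) H * (z G - z F))) * (A.hess F G H K *
        (y K - (y F + A.ind _ (A.sep F G) K * (y G - y F)))) := by
    intro z y
    refine Finset.sum_congr rfl fun H _ => ?_
    rw [← Finset.mul_sum, A.sum_hess_mul F G H
      (fun K => y K - (y F + A.ind _ (A.sep F G) K * (y G - y F)))
      (by rw [A.ind_of_notMem (A.sep_notMem h)]; ring)
      (by rw [A.ind_of_mem (A.sep_mem h)]; ring),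
      (A.indep F H).dvol_normalize, (A.indep H G).dvol_normalize]
    ring
  rw [key, key, Finset.sum_comm]
  refine Finset.sum_congr rfl fun H _ => Finset.sum_congr rfl fun K _ => ?_
  rw [A.hess_symm F G H K]
  ring

theorem dvol_X_mul_add {F G H : L} (hFH : F < H) (hHG : H < G) :
    A.dvol F H MvPolynomial.X * A.vol H G + A.vol F H * A.dvol H G MvPolynomial.X
      = MvPolynomial.C (A.deg F G - 1) * (A.vol F H * A.vol H G) := by
  rw [← A.deg_mul_vol hFH, ← A.deg_mul_vol hHG]
  have : A.deg F G - 1 = A.deg F H + A.deg H G := by unfold deg; ring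
  rw [this, map_add]
  ring

theorem ddvol_X (F G : L) (y : L → MvPolynomial L ℝ) :
    A.ddvol F G y MvPolynomial.X = MvPolynomial.C (A.deg F G - 1) * A.dvol F G y := by
  rw [ddvol, dvol, dvolAt, Finset.mul_sum]
  refine Finset.sum_congr rfl fun H _ => ?_
  by_cases hH : F < H ∧ H < G
  · rw [A.dvol_X_mul_add hH.1 hH.2]
    ring
  · rw [A.vol_mul_vol_eq_zero hH]
    by_cases h1 : F < H
    · have h2 : ¬ H < G := fun h2 => hH ⟨h1, h2⟩
      simp [A.vol_of_not_lt h2, A.dvol_of_not_lt h2]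
    · simp [A.vol_of_not_lt h1, A.dvol_of_not_lt h1]

theorem derivation_dvol_of (δ : Derivation ℝ (MvPolynomial L ℝ) (MvPolynomial L ℝ)) {F G : L}
    (hδ : ∀ H, F < H → H < G → δ (A.vol F H) = A.dvol F H (fun K => δ (MvPolynomial.X K)) ∧
      δ (A.vol H G) = A.dvol H G (fun K => δ (MvPolynomial.X K))) (y : L → MvPolynomial L ℝ) :
    δ (A.dvol F G y) = A.dvol F G (fun K => δ (y K)) +
      A.ddvol F G y (fun K => δ (MvPolynomial.X K)) := by
  rw [dvol, dvol, dvolAt, dvolAt, ddvol, map_sum, ← Finset.sum_add_distrib]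
  refine Finset.sum_congr rfl fun H _ => ?_
  rw [Derivation.leibniz, derivation_coeff]
  by_cases hH : F < H ∧ H < G
  · rw [Derivation.leibniz, (hδ H hH.1 hH.2).1, (hδ H hH.1 hH.2).2]
    simp only [smul_eq_mul]
    ring
  · rw [A.vol_mul_vol_eq_zero hH]
    by_cases h1 : F < H
    · have h2 : ¬ H < G := fun h2 => hH ⟨h1, h2⟩
      simp [A.vol_of_not_lt h2, A.dvol_of_not_lt h2]
    · simp [A.vol_of_not_lt h1, A.dvol_of_not_lt h1]

theorem derivation_vol (δ : Derivation ℝ (MvPolynomial L ℝ) (MvPolynomial L ℝ)) (F G : L) :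
    δ (A.vol F G) = A.dvol F G (fun K => δ (MvPolynomial.X K)) := by
  induction hn : A.rk G - A.rk F using Nat.strong_induction_on generalizing F G with
  | _ n IH =>
    subst hn
    by_cases h : F < G
    swap
    · rw [A.vol_of_not_lt h, A.dvol_of_not_lt h, map_zero]
    by_cases h' : A.rk G ≤ A.rk F + 1
    · rw [A.vol_of_rk_le h h', Derivation.map_one_eq_zero, dvol, dvolAt, Finset.sum_eq_zero]
      intro H _
      rw [A.vol_mul_vol_eq_zero_of_rk h', mul_zero]
    have hC : (MvPolynomial.C (A.deg F G) : MvPolynomial L ℝ) ≠ 0 := by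
      rw [Ne, MvPolynomial.C_eq_zero]
      linarith [A.one_le_deg h']
    apply mul_left_cancel₀ hC
    have h1 : δ (MvPolynomial.C (A.deg F G) * A.vol F G)
        = MvPolynomial.C (A.deg F G) * δ (A.vol F G) := by
      rw [← MvPolynomial.smul_eq_C_mul, Derivation.map_smul, MvPolynomial.smul_eq_C_mul]
    rw [← h1, A.deg_mul_vol h, A.derivation_dvol_of δ, A.ddvol_symm h, ddvol_X, map_sub, map_one]
    · ring
    · intro H h1 h2
      have := A.rk_lt h1
      have := A.rk_lt h2
      exact ⟨IH _ (by omega) _ _ rfl, IH _ (by omega) _ _ rfl⟩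

theorem derivation_dvol (δ : Derivation ℝ (MvPolynomial L ℝ) (MvPolynomial L ℝ)) (F G : L)
    (y : L → MvPolynomial L ℝ) :
    δ (A.dvol F G y) = A.dvol F G (fun K => δ (y K)) +
      A.ddvol F G y (fun K => δ (MvPolynomial.X K)) :=
  A.derivation_dvol_of δ (fun _ _ _ => ⟨A.derivation_vol δ _ _, A.derivation_vol δ _ _⟩) y

/-- Normalization of a direction by a weighted sum of indicators. -/
theorem dvol_sub_sum_ind (F G : L) (y : L → MvPolynomial L ℝ) (b : Finset E)
    (a c : MvPolynomial L ℝ) :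
    A.dvol F G (fun H => y H - (a + (∑ i ∈ b, A.ind _ i H) * c)) = A.dvol F G y := by
  classical
  induction b using Finset.induction_on generalizing a with
  | empty =>
    have h : (fun H => y H - (a + (∑ i ∈ (∅ : Finset E), A.ind (MvPolynomial L ℝ) i H) * c))
      = fun H => y H - (fun _ => a) H := by
      funext H
      simp
    rw [h, dvol_sub, dvol_const, sub_zero]
  | insert i b hi ih =>
    rw [← ih a, ← (A.indep F G).dvol_normalize
      (fun H => y H - (a + (∑ i ∈ b, A.ind _ i H) * c)) i 0 c]
    congr 1
    funext H
    rw [Finset.sum_insert hi]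
    ring

theorem derivation_vol_mul_vol (δ : Derivation ℝ (MvPolynomial L ℝ) (MvPolynomial L ℝ))
    (F H G : L) : δ (A.vol F H * A.vol H G)
      = A.dvol F H (fun K => δ (MvPolynomial.X K)) * A.vol H G
        + A.vol F H * A.dvol H G (fun K => δ (MvPolynomial.X K)) := by
  rw [Derivation.leibniz, derivation_vol, derivation_vol]
  simp only [smul_eq_mul]
  ring

theorem euler_second (δ : Derivation ℝ (MvPolynomial L ℝ) (MvPolynomial L ℝ)) {F G : L}
    (h : F < G) (hδ : ∀ K, δ (δ (MvPolynomial.X K)) = 0) (b : Finset E) (a c : ℝ)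
    (z : L → MvPolynomial L ℝ)
    (hz : ∀ H, z H = MvPolynomial.X H -
      (MvPolynomial.C a + (∑ i ∈ b, A.ind _ i H) * MvPolynomial.C c)) :
    MvPolynomial.C (A.deg F G - 2) * δ (δ (A.vol F G)) =
      ∑ H, (z H - A.ind _ (A.sep F G) H * z G - (1 - A.ind _ (A.sep F G) H) * z F) *
        δ (δ (A.vol F H * A.vol H G)) := by
  have hC : ∀ r : ℝ, δ (MvPolynomial.C r) = 0 := fun r => by
    rw [← MvPolynomial.algebraMap_eq, Derivation.map_algebraMap]
  have hzδ : ∀ H, δ (z H) = δ (MvPolynomial.X H) := by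
    intro H
    simp [hz, Derivation.leibniz, derivation_ind, hC]
  have h1 : MvPolynomial.C (A.deg F G) * A.vol F G = A.dvol F G z := by
    rw [A.deg_mul_vol h, funext hz, dvol_sub_sum_ind]
  have h2 : MvPolynomial.C (A.deg F G) * δ (A.vol F G) = δ (A.vol F G) +
      ∑ H, (z H - A.ind _ (A.sep F G) H * z G - (1 - A.ind _ (A.sep F G) H) * z F) *
        δ (A.vol F H * A.vol H G) := by
    have := congrArg δ h1
    rw [Derivation.leibniz, hC, derivation_dvol, funext hzδ, ← derivation_vol, ddvol] at this
    simp only [derivation_vol_mul_vol]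
    simpa using this
  have h3 : ∑ H, (δ (z H) - A.ind _ (A.sep F G) H * δ (z G)
      - (1 - A.ind _ (A.sep F G) H) * δ (z F)) * δ (A.vol F H * A.vol H G)
      = δ (δ (A.vol F G)) := by
    rw [A.derivation_vol δ F G, derivation_dvol, funext hδ, dvol_const, zero_add, ddvol]
    simp only [derivation_vol_mul_vol, hzδ]
  have h4 := congrArg δ h2
  rw [Derivation.leibniz, hC, map_add, map_sum] at h4
  simp only [Derivation.leibniz δ (_ - _) _, derivation_coeff, smul_eq_mul,
    Finset.sum_add_distrib] at h4
  have h5 : ∑ H, δ (A.vol F H * A.vol H G) * (δ (z H) - A.ind _ (A.sep F G) H * δ (z G)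
      - (1 - A.ind _ (A.sep F G) H) * δ (z F)) = δ (δ (A.vol F G)) := by
    rw [← h3]
    exact Finset.sum_congr rfl fun H _ => mul_comm _ _
  rw [h5] at h4
  have h6 : (MvPolynomial.C (A.deg F G - 2) : MvPolynomial L ℝ)
      = MvPolynomial.C (A.deg F G) - 1 - 1 := by
    rw [← MvPolynomial.C_1, ← map_sub, ← map_sub]
    congr 1
    ring
  rw [h6]
  linear_combination h4

end Derivation
end FlatLattice

namespace FlatLattice

variable {E L : Type} [PartialOrder L] (A : FlatLattice E L)
section Evaluation
variable [Nonempty E] [Fintype L] (v : L → ℝ)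

/-- The value of the volume polynomial at `v`. -/
noncomputable def val (F G : L) : ℝ := MvPolynomial.eval v (A.vol F G)

/-- The first derivative at `v` of the volume polynomial in the direction `y`. -/
noncomputable def val1 (F G : L) (y : L → ℝ) : ℝ :=
  MvPolynomial.eval v (A.dvol F G fun H => MvPolynomial.C (y H))

/-- The derivation of the polynomial ring given by a constant direction. -/
noncomputable def dirDeriv (y : L → ℝ) : Derivation ℝ (MvPolynomial L ℝ) (MvPolynomial L ℝ) :=
  MvPolynomial.mkDerivation ℝ fun H => MvPolynomial.C (y H)

/-- The second derivative at `v` of the volume polynomial in the direction `y`. -/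
noncomputable def val2 (F G : L) (y : L → ℝ) : ℝ :=
  MvPolynomial.eval v (dirDeriv y (dirDeriv y (A.vol F G)))

omit [Nonempty E] [Fintype L] in
theorem eval_ind (i : E) (H : L) : MvPolynomial.eval v (A.ind _ i H) = A.ind ℝ i H := by
  by_cases h : A.mem i H
  · simp [A.ind_of_mem h]
  · simp [A.ind_of_notMem h]

omit [PartialOrder L] [Fintype L] in
theorem dirDeriv_X (y : L → ℝ) (H : L) :
    dirDeriv y (MvPolynomial.X H) = MvPolynomial.C (y H) := by
  simp [dirDeriv, MvPolynomial.mkDerivation_X]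

omit [PartialOrder L] [Fintype L] in
theorem dirDeriv_C (y : L → ℝ) (r : ℝ) :
    dirDeriv y (MvPolynomial.C r) = 0 := by
  rw [← MvPolynomial.algebraMap_eq, Derivation.map_algebraMap]

theorem eval_dvol (F G : L) (y : L → MvPolynomial L ℝ) :
    MvPolynomial.eval v (A.dvol F G y)
      = A.val1 v F G (fun H => MvPolynomial.eval v (y H)) := by
  simp [val1, dvol, dvolAt, map_sum, eval_ind]

theorem val1_eq (F G : L) (y : L → ℝ) :
    A.val1 v F G y = ∑ H, (y H - A.ind _ (A.sep F G) H * y G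
      - (1 - A.ind _ (A.sep F G) H) * y F) * (A.val v F H * A.val v H G) := by
  simp [val1, dvol, dvolAt, map_sum, eval_ind, val]

theorem val1_eq_of_zero {F G : L} {y : L → ℝ} (hF : y F = 0) (hG : y G = 0) :
    A.val1 v F G y = ∑ H, y H * (A.val v F H * A.val v H G) := by
  simp [val1_eq, hF, hG]

theorem val_of_not_lt {F G : L} (h : ¬ F < G) : A.val v F G = 0 := by
  rw [val, A.vol_of_not_lt h, map_zero]

theorem val_of_rk_le {F G : L} (h : F < G) (h' : A.rk G ≤ A.rk F + 1) : A.val v F G = 1 := by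
  rw [val, A.vol_of_rk_le h h', map_one]

theorem val1_of_not_lt {F G : L} (h : ¬ F < G) (y : L → ℝ) : A.val1 v F G y = 0 := by
  rw [val1, A.dvol_of_not_lt h, map_zero]

theorem val1_of_rk_le {F G : L} (h' : A.rk G ≤ A.rk F + 1) (y : L → ℝ) :
    A.val1 v F G y = 0 := by
  rw [val1, dvol, dvolAt, Finset.sum_eq_zero, map_zero]
  intro H _
  rw [A.vol_mul_vol_eq_zero_of_rk h', mul_zero]

theorem deg_mul_val {F G : L} (h : F < G) : A.deg F G * A.val v F G = A.val1 v F G v := by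
  have := congrArg (MvPolynomial.eval v) (A.deg_mul_vol h)
  rw [eval_dvol] at this
  simpa [val] using this

theorem val1_sub_sum_ind (F G : L) (y : L → ℝ) (b : Finset E) (a c : ℝ) :
    A.val1 v F G (fun H => y H - (a + (∑ i ∈ b, A.ind _ i H) * c)) = A.val1 v F G y := by
  have := congrArg (MvPolynomial.eval v) (A.dvol_sub_sum_ind F G
    (fun H => MvPolynomial.C (y H)) b (MvPolynomial.C a) (MvPolynomial.C c))
  rw [eval_dvol, eval_dvol] at this
  simpa [eval_ind] using this

theorem val2_eq (F G : L) (y : L → ℝ) :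
    A.val2 v F G y = ∑ H, (y H - A.ind _ (A.sep F G) H * y G
      - (1 - A.ind _ (A.sep F G) H) * y F) *
      (A.val1 v F H y * A.val v H G + A.val v F H * A.val1 v H G y) := by
  rw [val2, A.derivation_vol, derivation_dvol]
  simp only [dirDeriv_X, dirDeriv_C, dvol_const, zero_add]
  simp [ddvol, val1, val, eval_ind]

theorem val2_eq_of_zero {F G : L} {y : L → ℝ} (hF : y F = 0) (hG : y G = 0) :
    A.val2 v F G y = ∑ H, y H *
      (A.val1 v F H y * A.val v H G + A.val v F H * A.val1 v H G y) := by
  simp [val2_eq, hF, hG]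

theorem val2_of_rk_le {F G : L} (h' : A.rk G ≤ A.rk F + 2) (y : L → ℝ) :
    A.val2 v F G y = 0 := by
  rw [val2_eq, Finset.sum_eq_zero]
  intro H _
  by_cases hF : F < H
  · by_cases hG : H < G
    · have := A.rk_lt hF
      have := A.rk_lt hG
      rw [A.val1_of_rk_le v (by omega), A.val1_of_rk_le v (by omega)]
      ring
    · rw [A.val1_of_not_lt v hG, A.val_of_not_lt v hG]
      ring
  · rw [A.val1_of_not_lt v hF, A.val_of_not_lt v hF]
    ring

/-- The direction `y` normalized to vanish at `F` and `G`. -/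
noncomputable def normalize (F G : L) (y : L → ℝ) (H : L) : ℝ :=
  y H - (y F + (∑ i ∈ {A.sep F G}, A.ind _ i H) * (y G - y F))

omit [Fintype L] in
theorem normalize_bot {F G : L} (h : F < G) (y : L → ℝ) : A.normalize F G y F = 0 := by
  simp [normalize, A.ind_of_notMem (A.sep_notMem h)]

omit [Fintype L] in
theorem normalize_top {F G : L} (h : F < G) (y : L → ℝ) : A.normalize F G y G = 0 := by
  simp [normalize, A.ind_of_mem (A.sep_mem h)]

theorem val1_normalize (F G F' G' : L) (y : L → ℝ) :
    A.val1 v F' G' (A.normalize F G y) = A.val1 v F' G' y :=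
  A.val1_sub_sum_ind v F' G' y _ _ _

theorem val2_normalize {F G : L} (h : F < G) (y : L → ℝ) :
    A.val2 v F G (A.normalize F G y) = A.val2 v F G y := by
  rw [A.val2_eq_of_zero v (A.normalize_bot h y) (A.normalize_top h y), val2_eq]
  simp only [val1_normalize]
  refine Finset.sum_congr rfl fun H _ => ?_
  simp only [normalize, Finset.sum_singleton]
  ring

theorem eval_dirDeriv_mul (F H G : L) (y : L → ℝ) :
    MvPolynomial.eval v (dirDeriv y (dirDeriv y (A.vol F H * A.vol H G)))
      = A.val2 v F H y * A.val v H G + 2 * (A.val1 v F H y * A.val1 v H G y)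
        + A.val v F H * A.val2 v H G y := by
  have h1 : ∀ F G, MvPolynomial.eval v (dirDeriv y (A.vol F G)) = A.val1 v F G y := by
    intro F G
    rw [derivation_vol, val1]
    simp only [dirDeriv_X]
  simp only [Derivation.leibniz, map_add, smul_eq_mul, map_mul, h1, val2, val]
  ring

theorem deg_sub_two_mul_val2 {F G : L} (h : F < G) (y : L → ℝ) (b : Finset E) (a w : ℝ)
    (hF : v F - (a + (∑ i ∈ b, A.ind _ i F) * w) = 0)
    (hG : v G - (a + (∑ i ∈ b, A.ind _ i G) * w) = 0) :
    (A.deg F G - 2) * A.val2 v F G y = ∑ H, (v H - (a + (∑ i ∈ b, A.ind _ i H) * w)) *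
      (A.val2 v F H y * A.val v H G + 2 * (A.val1 v F H y * A.val1 v H G y)
        + A.val v F H * A.val2 v H G y) := by
  have := congrArg (MvPolynomial.eval v) (A.euler_second (dirDeriv y) h
    (fun K => by rw [dirDeriv_X, dirDeriv_C]) b a w _ (fun _ => rfl))
  rw [map_sum] at this
  simp only [map_mul, eval_dirDeriv_mul, map_sub, map_add, map_sum, eval_ind, map_one,
    MvPolynomial.eval_X, MvPolynomial.eval_C, hF, hG, mul_zero, sub_zero] at this
  exact this

/-- The matrix of second derivatives at `v`. -/
noncomputable def hessVal (F G H K : L) : ℝ := MvPolynomial.eval v (A.hess F G H K)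

theorem sum_hessVal_mul {F G : L} (H : L) {y : L → ℝ} (hF : y F = 0) (hG : y G = 0) :
    ∑ K, A.hessVal v F G H K * y K
      = A.val1 v F H y * A.val v H G + A.val v F H * A.val1 v H G y := by
  have := congrArg (MvPolynomial.eval v) (A.sum_hess_mul F G H (fun H => MvPolynomial.C (y H))
    (by rw [hF, map_zero]) (by rw [hG, map_zero]))
  simpa [map_sum, hessVal, val, val1] using this

theorem hessVal_of_ne {F G H K : L} (h : H ≠ K) : A.hessVal v F G H K =
    A.val v F K * A.val v K H * A.val v H G + A.val v F H * A.val v H K * A.val v K G := by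
  rw [hessVal, hess, if_neg h]
  simp [val]

theorem hessVal_eq_zero {F G H K : L} (hH : F < H ∧ H < G) (hK : ¬ (F < K ∧ K < G)) :
    A.hessVal v F G H K = 0 := by
  rw [hessVal_of_ne]
  · by_cases hF : F < K
    · have hG : ¬ K < G := fun hG => hK ⟨hF, hG⟩
      rw [A.val_of_not_lt v hG, A.val_of_not_lt v fun h => hG (h.trans hH.2)]
      ring
    · rw [A.val_of_not_lt v hF, A.val_of_not_lt v fun h => hF (hH.1.trans h)]
      ring
  · rintro rfl
    exact hK hH

end Evaluation
end FlatLattice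

namespace FlatLattice

variable {E L : Type} [PartialOrder L] (A : FlatLattice E L)

/-- A direction is ample if on every interval it is equivalent, modulo linear functions, to a
direction which is positive on the proper part and zero at the ends. -/
def Ample (v : L → ℝ) : Prop :=
  ∀ F G, F < G → ∃ (b : Finset E) (a w : ℝ), v F - (a + (∑ i ∈ b, A.ind ℝ i F) * w) = 0 ∧
    v G - (a + (∑ i ∈ b, A.ind ℝ i G) * w) = 0 ∧
    ∀ H, F < H → H < G → 0 < v H - (a + (∑ i ∈ b, A.ind ℝ i H) * w)

theorem exists_between {F G : L} (h : F < G) (h' : ¬ A.rk G ≤ A.rk F + 1) :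
    ∃ H, F < H ∧ H < G ∧ A.rk H = A.rk F + 1 := by
  obtain ⟨i, hiG, hiF⟩ := A.exists_sep h
  obtain ⟨H, hFH, hiH, hrk, hmin⟩ := A.adjoin F i hiF
  refine ⟨H, hFH, lt_of_le_of_ne (hmin G h.le hiG) ?_, hrk⟩
  rintro rfl
  omega

theorem exists_atom {F G : L} (h : F < G) : ∃ H, F < H ∧ H ≤ G ∧ A.rk H = A.rk F + 1 := by
  obtain ⟨i, hiG, hiF⟩ := A.exists_sep h
  obtain ⟨H, hFH, hiH, hrk, hmin⟩ := A.adjoin F i hiF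
  exact ⟨H, hFH, hmin G h.le hiG, hrk⟩

theorem atom_le {F p K : L} (hp : F < p) (hrk : A.rk p = A.rk F + 1) {i : E} (hip : A.mem i p)
    (hiF : ¬ A.mem i F) (hFK : F ≤ K) (hiK : A.mem i K) : p ≤ K := by
  obtain ⟨H, hFH, hiH, hrkH, hmin⟩ := A.adjoin F i hiF
  have h1 : H = p := by
    by_contra hne
    have := A.rk_lt (lt_of_le_of_ne (hmin p hp.le hip) hne)
    omega
  exact h1 ▸ hmin K hFK hiK

/-- Two distinct points of an interval lie on a line. -/
theorem exists_line {F p q : L} (hp : F < p) (hrp : A.rk p = A.rk F + 1) (hq : F < q)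
    (hrq : A.rk q = A.rk F + 1) (hpq : p ≠ q) :
    ∃ l, p < l ∧ q < l ∧ A.rk l = A.rk F + 2 ∧ ∀ K, p ≤ K → q ≤ K → l ≤ K := by
  have hlt : ¬ q ≤ p := fun h => by
    have := A.rk_lt (lt_of_le_of_ne h hpq.symm)
    omega
  rw [A.le_iff] at hlt
  push Not at hlt
  obtain ⟨i, hiq, hip⟩ := hlt
  obtain ⟨l, hpl, hil, hrk, hmin⟩ := A.adjoin p i hip
  have hiF : ¬ A.mem i F := fun h => hip (A.mem_mono hp.le h)
  refine ⟨l, hpl, lt_of_le_of_ne (A.atom_le hq hrq hiq hiF (hp.trans hpl).le hil) ?_, by omega,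
    fun K h1 h2 => hmin K h1 (A.mem_mono h2 hiq)⟩
  rintro rfl
  omega

theorem eq_of_forall_lt {F G : L} (h3 : A.rk F + 3 ≤ A.rk G) {T : Type} (f : L → T)
    (hf : ∀ H K, F < H → H < K → K < G → f H = f K) {H K : L} (hH : F < H ∧ H < G)
    (hK : F < K ∧ K < G) : f H = f K := by
  have h1 : ∀ H, F < H → H < G → ∃ p, F < p ∧ p < G ∧ A.rk p = A.rk F + 1 ∧ p ≤ H ∧ f p = f H := by
    intro H hFH hHG
    obtain ⟨p, hp, hpH, hrk⟩ := A.exists_atom hFH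
    refine ⟨p, hp, hpH.trans_lt hHG, hrk, hpH, ?_⟩
    rcases hpH.eq_or_lt with h | h
    · rw [h]
    · exact hf _ _ hp h hHG
  obtain ⟨p, hFp, hpG, hrp, -, hfp⟩ := h1 H hH.1 hH.2
  obtain ⟨q, hFq, hqG, hrq, -, hfq⟩ := h1 K hK.1 hK.2
  rw [← hfp, ← hfq]
  by_cases hpq : p = q
  · rw [hpq]
  obtain ⟨l, hpl, hql, hrl, hmin⟩ := A.exists_line hFp hrp hFq hrq hpq
  have hlG : l < G := by
    refine lt_of_le_of_ne (hmin G hpG.le hqG.le) ?_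
    rintro rfl
    omega
  rw [hf p l hFp hpl hlG, hf q l hFq hql hlG]

end FlatLattice

theorem aczel_inequality {ι : Type} (s : Finset ι) (a b : ℝ) (u w : ι → ℝ)
    (h : 0 < a ^ 2 - ∑ i ∈ s, u i ^ 2) :
    (a ^ 2 - ∑ i ∈ s, u i ^ 2) * (b ^ 2 - ∑ i ∈ s, w i ^ 2)
      ≤ (a * b - ∑ i ∈ s, u i * w i) ^ 2 := by
  have hcs := Finset.sum_mul_sq_le_sq_mul_sq s u w
  have hU : 0 ≤ ∑ i ∈ s, u i ^ 2 := Finset.sum_nonneg fun i _ => sq_nonneg _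
  have hW : 0 ≤ ∑ i ∈ s, w i ^ 2 := Finset.sum_nonneg fun i _ => sq_nonneg _
  generalize ∑ i ∈ s, u i ^ 2 = U at *
  generalize ∑ i ∈ s, w i ^ 2 = W at *
  generalize ∑ i ∈ s, u i * w i = V at *
  rcases hU.eq_or_lt with h0 | h0
  · subst h0
    have hV : V = 0 := by
      rw [zero_mul] at hcs
      exact pow_eq_zero_iff two_ne_zero |>.1 (le_antisymm hcs (sq_nonneg _))
    subst hV
    nlinarith [mul_nonneg (sq_nonneg a) hW]
  · have h1 : 0 ≤ U * ((a * b - V) ^ 2 - (a ^ 2 - U) * (b ^ 2 - W)) := by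
      have h2 : U * ((a * b - V) ^ 2 - (a ^ 2 - U) * (b ^ 2 - W))
          = (b * U - a * V) ^ 2 + (a ^ 2 - U) * (U * W - V ^ 2) := by ring
      rw [h2]
      exact add_nonneg (sq_nonneg _) (mul_nonneg h.le (by linarith))
    linarith [nonneg_of_mul_nonneg_right h1 h0]

/-- The intersection form of a projective plane, given by the incidences of points and lines. -/
theorem point_line_form {ι : Type} [DecidableEq ι] (P Q : Finset ι) (m : ι → ι → ℝ)
    (hm : ∀ p l, m p l * m p l = m p l)
    (h1 : ∀ p ∈ P, ∀ q ∈ P, p ≠ q → ∑ l ∈ Q, m p l * m q l = 1) (x y : ι → ℝ) :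
    ∑ p ∈ P, x p * (∑ l ∈ Q, m p l * y l - (∑ l ∈ Q, m p l - 1) * y p)
        + ∑ l ∈ Q, x l * (∑ p ∈ P, m p l * y p - y l)
      = (∑ p ∈ P, x p) * (∑ p ∈ P, y p)
        - ∑ l ∈ Q, (x l - ∑ p ∈ P, m p l * x p) * (y l - ∑ p ∈ P, m p l * y p) := by
  have h2 : ∑ l ∈ Q, (∑ p ∈ P, m p l * x p) * (∑ p ∈ P, m p l * y p)
      = (∑ p ∈ P, x p) * (∑ p ∈ P, y p) + ∑ p ∈ P, (∑ l ∈ Q, m p l - 1) * (x p * y p) := by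
    have h3 : ∀ p ∈ P, ∀ q ∈ P, ∑ l ∈ Q, m p l * x p * (m q l * y q)
        = x p * y q + if p = q then (∑ l ∈ Q, m p l - 1) * (x p * y q) else 0 := by
      intro p hp q hq
      have h4 : ∑ l ∈ Q, m p l * x p * (m q l * y q)
          = (∑ l ∈ Q, m p l * m q l) * (x p * y q) := by
        rw [Finset.sum_mul]
        exact Finset.sum_congr rfl fun l _ => by ring
      rw [h4]
      split_ifs with h
      · subst h
        simp only [hm]
        ring
      · rw [h1 p hp q hq h]
        ring
    simp only [Finset.sum_mul_sum]
    rw [Finset.sum_comm, ← Finset.sum_add_distrib]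
    refine Finset.sum_congr rfl fun p hp => ?_
    rw [Finset.sum_comm, Finset.sum_congr rfl (h3 p hp), Finset.sum_add_distrib]
    simp [hp]
  have h5 : ∑ p ∈ P, x p * ∑ l ∈ Q, m p l * y l = ∑ l ∈ Q, (∑ p ∈ P, m p l * x p) * y l := by
    simp only [Finset.mul_sum, Finset.sum_mul]
    rw [Finset.sum_comm]
    exact Finset.sum_congr rfl fun l _ => Finset.sum_congr rfl fun p _ => by ring
  have h6 : ∀ l, (x l - ∑ p ∈ P, m p l * x p) * (y l - ∑ p ∈ P, m p l * y p)
      = -(x l * (∑ p ∈ P, m p l * y p - y l)) - (∑ p ∈ P, m p l * x p) * y l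
        + (∑ p ∈ P, m p l * x p) * (∑ p ∈ P, m p l * y p) := fun l => by ring
  have h7 : ∀ p, x p * (∑ l ∈ Q, m p l * y l - (∑ l ∈ Q, m p l - 1) * y p)
      = x p * (∑ l ∈ Q, m p l * y l) - (∑ l ∈ Q, m p l - 1) * (x p * y p) := fun p => by ring
  simp only [h6, h7, Finset.sum_add_distrib, Finset.sum_sub_distrib, Finset.sum_neg_distrib, h2,
    h5]
  ring

/-- The quadratic inequality for a product follows from those of the factors. -/
theorem product_quadratic_inequality {a b f g p₁ p₂ q₁ q₂ : ℝ}
    (ha : (a = 0 ∧ p₁ = 0 ∧ q₁ = 0) ∨ (1 ≤ a ∧ a * f * q₁ ≤ (a - 1) * p₁ ^ 2))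
    (hb : (b = 0 ∧ p₂ = 0 ∧ q₂ = 0) ∨ (1 ≤ b ∧ b * g * q₂ ≤ (b - 1) * p₂ ^ 2)) :
    (a + b) * (f * g) * (q₁ * g + 2 * (p₁ * p₂) + f * q₂)
      ≤ (a + b - 1) * (p₁ * g + f * p₂) ^ 2 := by
  rcases ha with ⟨ha, hp, hq⟩ | ⟨ha, hq⟩
  · subst ha hp hq
    rcases hb with ⟨hb, hp, hq⟩ | ⟨hb, hq'⟩
    · subst hb hp hq
      simp
    · have := mul_le_mul_of_nonneg_left hq' (sq_nonneg f)
      linarith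
  rcases hb with ⟨hb, hp, hq'⟩ | ⟨hb, hq'⟩
  · subst hb hp hq'
    have := mul_le_mul_of_nonneg_left hq (sq_nonneg g)
    linarith
  have h1 := mul_le_mul_of_nonneg_left hq (mul_nonneg (by linarith : 0 ≤ b) (sq_nonneg g))
  have h2 := mul_le_mul_of_nonneg_left hq' (mul_nonneg (by linarith : 0 ≤ a) (sq_nonneg f))
  have hab : 0 < a * b := by positivity
  have h3 : 0 ≤ (a * b) * ((a + b - 1) * (p₁ * g + f * p₂) ^ 2
      - (a + b) * (f * g) * (q₁ * g + 2 * (p₁ * p₂) + f * q₂)) := by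
    nlinarith [mul_le_mul_of_nonneg_left h1 (by linarith : 0 ≤ a + b),
      mul_le_mul_of_nonneg_left h2 (by linarith : 0 ≤ a + b),
      sq_nonneg (b * (p₁ * g) - a * (f * p₂))]
  linarith [nonneg_of_mul_nonneg_right h3 hab]

namespace FlatLattice

variable {E L : Type} [PartialOrder L] (A : FlatLattice E L)
section Lorentz
variable [Nonempty E] [Fintype L] {v : L → ℝ}

theorem val_mul_val_eq_zero {F G H : L} (h : ¬ (F < H ∧ H < G)) :
    A.val v F H * A.val v H G = 0 := by
  by_cases hF : F < H
  · rw [A.val_of_not_lt v (F := H) fun hG => h ⟨hF, hG⟩, mul_zero]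
  · rw [A.val_of_not_lt v hF, zero_mul]

theorem val_pos (hv : A.Ample v) {F G : L} (h : F < G) : 0 < A.val v F G := by
  induction hn : A.rk G - A.rk F using Nat.strong_induction_on generalizing F G with
  | _ n IH =>
    subst hn
    by_cases h' : A.rk G ≤ A.rk F + 1
    · rw [A.val_of_rk_le v h h']
      exact one_pos
    have hd : 0 < A.deg F G := by linarith [A.one_le_deg h']
    refine pos_of_mul_pos_right (a := A.deg F G) ?_ hd.le
    obtain ⟨b, a, w, hF, hG, hpos⟩ := hv F G h
    rw [A.deg_mul_val v h, ← A.val1_sub_sum_ind v F G v b a w, A.val1_eq_of_zero v hF hG]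
    have ihp : ∀ H, F < H → H < G → 0 < A.val v F H * A.val v H G := by
      intro H h1 h2
      have := A.rk_lt h1
      have := A.rk_lt h2
      exact mul_pos (IH _ (by omega) h1 rfl) (IH _ (by omega) h2 rfl)
    refine Finset.sum_pos' (fun H _ => ?_) ?_
    · by_cases hH : F < H ∧ H < G
      · exact (mul_pos (hpos H hH.1 hH.2) (ihp H hH.1 hH.2)).le
      · rw [A.val_mul_val_eq_zero hH, mul_zero]
    · obtain ⟨H, h1, h2, -⟩ := A.exists_between h h'
      exact ⟨H, Finset.mem_univ _, mul_pos (hpos H h1 h2) (ihp H h1 h2)⟩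

theorem val_nonneg (hv : A.Ample v) (F G : L) : 0 ≤ A.val v F G := by
  by_cases h : F < G
  · exact (A.val_pos hv h).le
  · rw [A.val_of_not_lt v h]

/-- The bilinear form of second derivatives, evaluated at an ample class. -/
theorem val1_self_mul_add {F H G : L} (hFH : F < H) (hHG : H < G) {c : L → ℝ}
    (hc : ∀ F G, A.val1 v F G c = A.val1 v F G v) :
    A.val1 v F H c * A.val v H G + A.val v F H * A.val1 v H G c
      = (A.deg F G - 1) * (A.val v F H * A.val v H G) := by
  rw [hc, hc, ← A.deg_mul_val v hFH, ← A.deg_mul_val v hHG]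
  have : A.deg F G - 1 = A.deg F H + A.deg H G := by unfold deg; ring
  rw [this]
  ring

theorem sum_mul_val1_self {F G : L} {c : L → ℝ} (hc : ∀ F G, A.val1 v F G c = A.val1 v F G v)
    {y : L → ℝ} (hF : y F = 0) (hG : y G = 0) :
    ∑ H, y H * (A.val1 v F H c * A.val v H G + A.val v F H * A.val1 v H G c)
      = (A.deg F G - 1) * A.val1 v F G y := by
  rw [A.val1_eq_of_zero v hF hG, Finset.mul_sum]
  refine Finset.sum_congr rfl fun H _ => ?_
  by_cases hH : F < H ∧ H < G
  · rw [A.val1_self_mul_add hH.1 hH.2 hc]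
    ring
  · rw [A.val_mul_val_eq_zero hH]
    by_cases h1 : F < H
    · have h2 : ¬ H < G := fun h2 => hH ⟨h1, h2⟩
      simp [A.val_of_not_lt v h2, A.val1_of_not_lt v h2]
    · simp [A.val_of_not_lt v h1, A.val1_of_not_lt v h1]

/-- The Hodge-index type inequality of an interval. -/
theorem deg_mul_val2_le_of_hodge {F G : L} (h : F < G) (hd : 1 < A.deg F G) {c : L → ℝ}
    (hcF : c F = 0) (hcG : c G = 0) (hc : ∀ F G, A.val1 v F G c = A.val1 v F G v)
    (hodge : ∀ y : L → ℝ, y F = 0 → y G = 0 →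
      (∑ H, c H * (A.val1 v F H c * A.val v H G + A.val v F H * A.val1 v H G c)) *
        (∑ H, y H * (A.val1 v F H y * A.val v H G + A.val v F H * A.val1 v H G y))
      ≤ (∑ H, y H * (A.val1 v F H c * A.val v H G + A.val v F H * A.val1 v H G c)) ^ 2)
    (y : L → ℝ) :
    A.deg F G * A.val v F G * A.val2 v F G y ≤ (A.deg F G - 1) * A.val1 v F G y ^ 2 := by
  have h2 := hodge _ (A.normalize_bot h y) (A.normalize_top h y)
  rw [← A.val2_eq_of_zero v (A.normalize_bot h y) (A.normalize_top h y),
    A.sum_mul_val1_self hc (A.normalize_bot h y) (A.normalize_top h y),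
    A.sum_mul_val1_self hc hcF hcG, A.val2_normalize v h,
    A.val1_normalize, hc, ← A.deg_mul_val v h] at h2
  have h3 : 0 < A.deg F G - 1 := by linarith
  nlinarith

theorem hodge_two {F G : L} (h : F < G) (h3 : A.rk G = A.rk F + 3) {c : L → ℝ}
    (hpos : 0 < ∑ H, c H * (A.val1 v F H c * A.val v H G + A.val v F H * A.val1 v H G c))
    (hcF : c F = 0) (hcG : c G = 0) (y : L → ℝ) (hyF : y F = 0) (hyG : y G = 0) :
    (∑ H, c H * (A.val1 v F H c * A.val v H G + A.val v F H * A.val1 v H G c)) *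
        (∑ H, y H * (A.val1 v F H y * A.val v H G + A.val v F H * A.val1 v H G y))
      ≤ (∑ H, y H * (A.val1 v F H c * A.val v H G + A.val v F H * A.val1 v H G c)) ^ 2 := by
  classical
  let P : Finset L := Finset.univ.filter fun H => F < H ∧ H < G ∧ A.rk H = A.rk F + 1
  let Q : Finset L := Finset.univ.filter fun H => F < H ∧ H < G ∧ A.rk H = A.rk F + 2
  let m : L → L → ℝ := fun p l => if p < l then 1 else 0
  have hP : ∀ p, p ∈ P ↔ F < p ∧ p < G ∧ A.rk p = A.rk F + 1 := fun p => by simp [P]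
  have hQ : ∀ p, p ∈ Q ↔ F < p ∧ p < G ∧ A.rk p = A.rk F + 2 := fun p => by simp [Q]
  have hm : ∀ p l, m p l * m p l = m p l := by
    intro p l
    simp [m]
  have hvm : ∀ K l, A.rk l ≤ A.rk K + 1 → A.val v K l = m K l := by
    intro K l hr
    by_cases hlt : K < l
    · rw [A.val_of_rk_le v hlt hr]
      simp [m, hlt]
    · rw [A.val_of_not_lt v hlt]
      simp [m, hlt]
  have h1 : ∀ p ∈ P, ∀ q ∈ P, p ≠ q → ∑ l ∈ Q, m p l * m q l = 1 := by
    intro p hp q hq hpq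
    rw [hP] at hp hq
    obtain ⟨l, hpl, hql, hrk, hmin⟩ := A.exists_line hp.1 hp.2.2 hq.1 hq.2.2 hpq
    have hlG : l < G := by
      refine lt_of_le_of_ne (hmin G hp.2.1.le hq.2.1.le) ?_
      rintro rfl
      omega
    rw [Finset.sum_eq_single l]
    · simp [m, hpl, hql]
    · intro K hK hKl
      rw [hQ] at hK
      by_cases hpK : p < K
      · by_cases hqK : q < K
        · have := A.rk_lt (lt_of_le_of_ne (hmin K hpK.le hqK.le) hKl.symm)
          omega
        · simp [m, hqK]
      · simp [m, hpK]
    · intro hl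
      exact absurd ((hQ l).2 ⟨hp.1.trans hpl, hlG, hrk⟩) hl
  have hsplit : ∀ f : L → ℝ, (∀ H, ¬ (F < H ∧ H < G) → f H = 0) →
      ∑ H, f H = ∑ p ∈ P, f p + ∑ l ∈ Q, f l := by
    intro f hf
    rw [← Finset.sum_union]
    · refine (Finset.sum_subset (Finset.subset_univ _) fun H _ hH => hf H fun h' => hH ?_).symm
      have := A.rk_lt h'.1
      have := A.rk_lt h'.2
      rw [Finset.mem_union, hP, hQ]
      rcases (by omega : A.rk H = A.rk F + 1 ∨ A.rk H = A.rk F + 2) with h2 | h2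
      · exact Or.inl ⟨h'.1, h'.2, h2⟩
      · exact Or.inr ⟨h'.1, h'.2, h2⟩
    · rw [Finset.disjoint_left]
      intro H h1 h2
      rw [hP] at h1
      rw [hQ] at h2
      omega
  have hstar : ∀ (F' G' : L), F' < G' → A.rk G' = A.rk F' + 2 →
      ∑ H, A.ind ℝ (A.sep F' G') H * (A.val v F' H * A.val v H G') = 1 := by
    intro F' G' hlt hr
    have := congrArg (MvPolynomial.eval v) (A.rk_two_sum F' G' hlt hr (A.sep_mem hlt)
      (A.sep_notMem hlt))
    simpa [starSum, map_sum, eval_ind, val] using this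
  have hoff : ∀ (z : L → ℝ) (H : L), ¬ (F < H ∧ H < G) →
      A.val1 v F H z * A.val v H G + A.val v F H * A.val1 v H G z = 0 := by
    intro z H hH
    by_cases h1 : F < H
    · have h2 : ¬ H < G := fun h2 => hH ⟨h1, h2⟩
      simp [A.val_of_not_lt v h2, A.val1_of_not_lt v h2]
    · simp [A.val_of_not_lt v h1, A.val1_of_not_lt v h1]
  have hval1 : ∀ (F' G' : L) (z : L → ℝ), F' < G' → A.rk G' = A.rk F' + 2 →
      A.val1 v F' G' z = ∑ H, z H * (A.val v F' H * A.val v H G') - z G'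
        - z F' * (∑ H, A.val v F' H * A.val v H G' - 1) := by
    intro F' G' z hlt hr
    have h2 : ∀ H, (z H - A.ind _ (A.sep F' G') H * z G' - (1 - A.ind _ (A.sep F' G') H) * z F') *
        (A.val v F' H * A.val v H G') = z H * (A.val v F' H * A.val v H G')
          - z G' * (A.ind _ (A.sep F' G') H * (A.val v F' H * A.val v H G'))
          - z F' * (A.val v F' H * A.val v H G'
            - A.ind _ (A.sep F' G') H * (A.val v F' H * A.val v H G')) := fun H => by ring
    simp only [val1_eq, h2, Finset.sum_sub_distrib, ← Finset.mul_sum, hstar F' G' hlt hr, mul_one]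
  have hpt : ∀ (z : L → ℝ), z G = 0 → ∀ p ∈ P,
      A.val1 v F p z * A.val v p G + A.val v F p * A.val1 v p G z
        = ∑ l ∈ Q, m p l * z l - (∑ l ∈ Q, m p l - 1) * z p := by
    intro z hz p hp
    rw [hP] at hp
    have hs : ∀ f : L → ℝ, ∑ H, f H * (A.val v p H * A.val v H G) = ∑ l ∈ Q, f l * m p l := by
      intro f
      rw [← Finset.sum_subset (Finset.subset_univ Q)]
      · refine Finset.sum_congr rfl fun l hl => ?_
        rw [hQ] at hl
        rw [A.val_of_rk_le v hl.2.1 (by omega), hvm p l (by omega), mul_one]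
      · intro H _ hH
        rw [A.val_mul_val_eq_zero, mul_zero]
        rintro ⟨h1, h2⟩
        have := A.rk_lt h1
        have := A.rk_lt h2
        exact hH ((hQ H).2 ⟨hp.1.trans h1, h2, by omega⟩)
    have hs1 := hs fun _ => 1
    simp only [one_mul] at hs1
    rw [A.val1_of_rk_le v (by omega), A.val_of_rk_le v hp.1 (by omega),
      hval1 p G z hp.2.1 (by omega), hz, hs, hs1]
    simp only [mul_comm (z _) (m _ _)]
    ring
  have hln : ∀ (z : L → ℝ), z F = 0 → ∀ l ∈ Q,
      A.val1 v F l z * A.val v l G + A.val v F l * A.val1 v l G z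
        = ∑ p ∈ P, m p l * z p - z l := by
    intro z hz l hl
    rw [hQ] at hl
    have hs : ∀ f : L → ℝ, ∑ H, f H * (A.val v F H * A.val v H l) = ∑ p ∈ P, f p * m p l := by
      intro f
      rw [← Finset.sum_subset (Finset.subset_univ P)]
      · refine Finset.sum_congr rfl fun p hp => ?_
        rw [hP] at hp
        rw [A.val_of_rk_le v hp.1 (by omega), hvm p l (by omega), one_mul]
      · intro H _ hH
        rw [A.val_mul_val_eq_zero, mul_zero]
        rintro ⟨h1, h2⟩
        have := A.rk_lt h1
        have := A.rk_lt h2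
        exact hH ((hP H).2 ⟨h1, h2.trans hl.2.1, by omega⟩)
    rw [A.val1_of_rk_le v (F := l) (by omega), A.val_of_rk_le v hl.2.1 (by omega),
      hval1 F l z hl.1 (by omega), hz, hs]
    simp only [mul_comm (z _) (m _ _)]
    ring
  have hform : ∀ x z : L → ℝ, z F = 0 → z G = 0 →
      ∑ H, x H * (A.val1 v F H z * A.val v H G + A.val v F H * A.val1 v H G z)
        = (∑ p ∈ P, x p) * (∑ p ∈ P, z p)
          - ∑ l ∈ Q, (x l - ∑ p ∈ P, m p l * x p) * (z l - ∑ p ∈ P, m p l * z p) := by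
    intro x z hF hG
    rw [← point_line_form P Q m hm h1, hsplit _ fun H hH => by rw [hoff z H hH, mul_zero]]
    congr 1
    · exact Finset.sum_congr rfl fun p hp => by rw [hpt z hG p hp]
    · exact Finset.sum_congr rfl fun p hp => by rw [hln z hF p hp]
  rw [hform c c hcF hcG] at hpos ⊢
  rw [hform y y hyF hyG, hform y c hcF hcG]
  simp only [← pow_two] at hpos ⊢
  refine (aczel_inequality Q _ _ _ _ hpos).trans_eq ?_
  rw [mul_comm (∑ p ∈ P, c p)]
  congr 2
  exact Finset.sum_congr rfl fun l _ => mul_comm _ _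

theorem hodge_of_quadratic (hv : A.Ample v) {F G : L} (h3 : A.rk F + 3 ≤ A.rk G)
    {c : L → ℝ} (hcF : c F = 0) (hcG : c G = 0) (hcpos : ∀ H, F < H → H < G → 0 < c H)
    (hc : ∀ F G, A.val1 v F G c = A.val1 v F G v)
    (hloc : ∀ y : L → ℝ, y F = 0 → y G = 0 → A.val2 v F G y ≤
      ∑ H, c H * (A.val1 v F H y * A.val v H G + A.val v F H * A.val1 v H G y) ^ 2 /
        ((A.deg F G - 1) * (A.val v F H * A.val v H G)))
    (y : L → ℝ) (hyF : y F = 0) (hyG : y G = 0) :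
    (∑ H, c H * (A.val1 v F H c * A.val v H G + A.val v F H * A.val1 v H G c)) *
        (∑ H, y H * (A.val1 v F H y * A.val v H G + A.val v F H * A.val1 v H G y))
      ≤ (∑ H, y H * (A.val1 v F H c * A.val v H G + A.val v F H * A.val1 v H G c)) ^ 2 := by
  classical
  let n := {H : L // F < H ∧ H < G}
  let M : Matrix n n ℝ := fun H K => A.hessVal v F G H.1 K.1
  have hsum : ∀ f : L → ℝ, (∀ H, ¬ (F < H ∧ H < G) → f H = 0) → ∑ H, f H = ∑ H : n, f H.1 := by
    intro f hf
    rw [← Finset.sum_subset (Finset.filter_subset (fun H => F < H ∧ H < G) Finset.univ)]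
    · exact Finset.sum_subtype _ (by simp) f
    · intro H _ hH
      exact hf H (by simpa using hH)
  have hmul : ∀ z : L → ℝ, z F = 0 → z G = 0 → ∀ H : n, M.mulVec (fun K => z K.1) H
      = A.val1 v F H.1 z * A.val v H.1 G + A.val v F H.1 * A.val1 v H.1 G z := by
    intro z hF hG H
    rw [← A.sum_hessVal_mul v H.1 hF hG, hsum]
    · rfl
    · intro K hK
      rw [A.hessVal_eq_zero v H.2 hK, zero_mul]
  have hdot : ∀ x z : L → ℝ, z F = 0 → z G = 0 →
      ∑ H, x H * (A.val1 v F H z * A.val v H G + A.val v F H * A.val1 v H G z)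
        = dotProduct (fun K : n => x K.1) (M.mulVec fun K => z K.1) := by
    intro x z hF hG
    rw [hsum]
    · exact Finset.sum_congr rfl fun H _ => by rw [hmul z hF hG]
    · intro H hH
      by_cases h1 : F < H
      · have h2 : ¬ H < G := fun h2 => hH ⟨h1, h2⟩
        simp [A.val_of_not_lt v h2, A.val1_of_not_lt v h2]
      · simp [A.val_of_not_lt v h1, A.val1_of_not_lt v h1]
  have hM : M.IsSymm := by
    ext H K
    change A.hessVal v F G K.1 H.1 = A.hessVal v F G H.1 K.1
    rw [hessVal, hess_symm, hessVal]
  have hd : 0 < A.deg F G - 1 := by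
    have : (A.rk F : ℝ) + 3 ≤ A.rk G := by exact_mod_cast h3
    unfold deg
    linarith
  have hMc : ∀ H : n, M.mulVec (fun K => c K.1) H
      = (A.deg F G - 1) * (A.val v F H.1 * A.val v H.1 G) := by
    intro H
    rw [hmul c hcF hcG, A.val1_self_mul_add H.2.1 H.2.2 hc]
  have key := hodge_index_of_quadratic hM (c := fun H : n => c H.1) ?_ ?_ ?_ ?_ ?_
    (fun H : n => y H.1)
  · rw [hdot c c hcF hcG, hdot y y hyF hyG, hdot y c hcF hcG]
    refine key.trans_eq ?_
    rw [Matrix.dotProduct_mulVec, ← Matrix.mulVec_transpose, hM, dotProduct_comm]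
  · intro H K hHK
    have hne : H.1 ≠ K.1 := fun h => hHK (Subtype.ext h)
    change 0 ≤ A.hessVal v F G H.1 K.1
    rw [A.hessVal_of_ne v hne]
    exact add_nonneg
      (mul_nonneg (mul_nonneg (A.val_nonneg hv _ _) (A.val_nonneg hv _ _)) (A.val_nonneg hv _ _))
      (mul_nonneg (mul_nonneg (A.val_nonneg hv _ _) (A.val_nonneg hv _ _)) (A.val_nonneg hv _ _))
  · intro f hf H K
    have := A.eq_of_forall_lt h3 (fun H => if h : F < H ∧ H < G then f ⟨H, h⟩ else 0)
      (fun H K h1 h2 h4 => ?_) H.2 K.2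
    · simpa [H.2, K.2] using this
    · have h5 : F < K := h1.trans h2
      have h6 : H < G := h2.trans h4
      simp only [h1, h6, h5, h4, and_self, dite_true]
      apply hf
      · intro h
        exact h2.ne (congrArg Subtype.val h)
      · change 0 < A.hessVal v F G H K
        rw [A.hessVal_of_ne v h2.ne]
        exact add_pos_of_nonneg_of_pos
          (mul_nonneg (mul_nonneg (A.val_nonneg hv _ _) (A.val_nonneg hv _ _))
            (A.val_nonneg hv _ _))
          (mul_pos (mul_pos (A.val_pos hv h1) (A.val_pos hv h2)) (A.val_pos hv h4))
  · exact fun H => hcpos H.1 H.2.1 H.2.2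
  · intro H
    rw [hMc]
    exact mul_pos hd (mul_pos (A.val_pos hv H.2.1) (A.val_pos hv H.2.2))
  · intro z
    let z' : L → ℝ := fun H => if h : F < H ∧ H < G then z ⟨H, h⟩ else 0
    have hz : z = fun H : n => z' H.1 := by
      funext H
      simp only [z']
      rw [dif_pos H.2]
    have hF : z' F = 0 := by simp [z']
    have hG : z' G = 0 := by simp [z']
    have h1 := hloc z' hF hG
    rw [A.val2_eq_of_zero v hF hG, hdot z' z' hF hG, hsum] at h1
    · rw [hz]
      refine h1.trans_eq ?_
      refine Finset.sum_congr rfl fun H _ => ?_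
      rw [hmul z' hF hG, hMc]
    · intro H hH
      rw [A.val_mul_val_eq_zero hH]
      simp

/-- The Lorentzian inequality for the volume polynomial at an ample class. -/
theorem deg_mul_val2_le (hv : A.Ample v) {F G : L} (h : F < G) (h2 : A.rk F + 2 ≤ A.rk G)
    (y : L → ℝ) :
    A.deg F G * A.val v F G * A.val2 v F G y ≤ (A.deg F G - 1) * A.val1 v F G y ^ 2 := by
  induction hn : A.rk G - A.rk F using Nat.strong_induction_on generalizing F G y with
  | _ n IH =>
    subst hn
    by_cases h' : A.rk G ≤ A.rk F + 2
    · have hd : A.deg F G = 1 := by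
        have h3 : A.rk G = A.rk F + 2 := by omega
        have : (A.rk G : ℝ) = A.rk F + 2 := by exact_mod_cast h3
        unfold deg
        linarith
      rw [A.val2_of_rk_le v h', hd]
      simp
    have h3 : A.rk F + 3 ≤ A.rk G := by omega
    have h3r : (A.rk F : ℝ) + 3 ≤ A.rk G := by exact_mod_cast h3
    have hd : 2 ≤ A.deg F G := by
      unfold deg
      linarith
    obtain ⟨b, a, w, hF, hG, hpos⟩ := hv F G h
    have hc : ∀ F G, A.val1 v F G (fun H => v H - (a + (∑ i ∈ b, A.ind ℝ i H) * w))
        = A.val1 v F G v := fun F G => A.val1_sub_sum_ind v F G v b a w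
    refine A.deg_mul_val2_le_of_hodge h (by linarith) hF hG hc ?_ y
    rcases h3.eq_or_lt with h3' | h3'
    · intro y
      refine A.hodge_two h h3'.symm ?_ hF hG y
      rw [A.sum_mul_val1_self hc hF hG, hc, ← A.deg_mul_val v h]
      exact mul_pos (by linarith) (mul_pos (by linarith) (A.val_pos hv h))
    · have h4r : (A.rk F : ℝ) + 4 ≤ A.rk G := by exact_mod_cast h3'
      have hd3 : 3 ≤ A.deg F G := by
        unfold deg
        linarith
      refine A.hodge_of_quadratic hv h3 hF hG hpos hc ?_
      intro y hyF hyG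
      have hE := A.deg_sub_two_mul_val2 v h y b a w hF hG
      have hle : (A.deg F G - 2) * A.val2 v F G y ≤ (A.deg F G - 2) *
          ∑ H, (v H - (a + (∑ i ∈ b, A.ind ℝ i H) * w)) *
            (A.val1 v F H y * A.val v H G + A.val v F H * A.val1 v H G y) ^ 2 /
            ((A.deg F G - 1) * (A.val v F H * A.val v H G)) := by
        rw [hE, Finset.mul_sum]
        refine Finset.sum_le_sum fun H _ => ?_
        by_cases hH : F < H ∧ H < G
        swap
        · rw [A.val_mul_val_eq_zero hH]
          have h0 : A.val2 v F H y * A.val v H G + 2 * (A.val1 v F H y * A.val1 v H G y)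
              + A.val v F H * A.val2 v H G y = 0 := by
            have hz : ∀ F G : L, ¬ F < G → A.val2 v F G y = 0 := by
              intro F G h
              rw [val2, A.vol_of_not_lt h]
              simp
            by_cases h1 : F < H
            · have h2 : ¬ H < G := fun h2 => hH ⟨h1, h2⟩
              simp [A.val_of_not_lt v h2, A.val1_of_not_lt v h2, hz _ _ h2]
            · simp [A.val_of_not_lt v h1, A.val1_of_not_lt v h1, hz _ _ h1]
          rw [h0]
          simp
        obtain ⟨hFH, hHG⟩ := hH
        have r1 := A.rk_lt hFH
        have r2 := A.rk_lt hHG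
        have hcase : ∀ F' G' : L, F' < G' → A.rk G' - A.rk F' < A.rk G - A.rk F →
            (A.deg F' G' = 0 ∧ A.val1 v F' G' y = 0 ∧ A.val2 v F' G' y = 0) ∨
            (1 ≤ A.deg F' G' ∧ A.deg F' G' * A.val v F' G' * A.val2 v F' G' y
              ≤ (A.deg F' G' - 1) * A.val1 v F' G' y ^ 2) := by
          intro F' G' h' hr
          by_cases h1 : A.rk G' ≤ A.rk F' + 1
          · exact Or.inl ⟨A.deg_eq_zero h' h1, A.val1_of_rk_le v h1 y,
              A.val2_of_rk_le v (by omega) y⟩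
          · exact Or.inr ⟨A.one_le_deg h1, IH _ hr h' (by omega) y rfl⟩
        have hprod := product_quadratic_inequality (hcase F H hFH (by omega))
          (hcase H G hHG (by omega))
        have hdd : A.deg F H + A.deg H G = A.deg F G - 1 := by unfold deg; ring
        rw [hdd] at hprod
        have hpp : 0 < (A.deg F G - 1) * (A.val v F H * A.val v H G) :=
          mul_pos (by linarith) (mul_pos (A.val_pos hv hFH) (A.val_pos hv hHG))
        rw [mul_div_assoc, mul_left_comm (A.deg F G - 2)]
        refine mul_le_mul_of_nonneg_left ?_ (hpos H hFH hHG).le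
        rw [← mul_div_assoc, le_div_iff₀ hpp]
        linarith
      exact le_of_mul_le_mul_left hle (by linarith)

end Lorentz
end FlatLattice

namespace FlatLattice

variable {E L : Type} [PartialOrder L] (A : FlatLattice E L)

theorem rk_mono {F G : L} (h : F ≤ G) : A.rk F ≤ A.rk G := by
  rcases h.eq_or_lt with rfl | h
  · exact le_rfl
  · exact (A.rk_lt h).le

open Classical in
/-- Every interval has a basis. -/
theorem exists_basis {F G : L} (h : F ≤ G) : ∃ b : Finset E, (∀ i ∈ b, A.mem i G ∧ ¬ A.mem i F) ∧
    b.card + A.rk F = A.rk G ∧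
    ∀ H, F ≤ H → (b.filter fun i => A.mem i H).card + A.rk F ≤ A.rk H := by
  induction hn : A.rk G - A.rk F using Nat.strong_induction_on generalizing F with
  | _ n IH =>
    subst hn
    rcases h.eq_or_lt with rfl | h
    · exact ⟨∅, by simp, by simp, fun H hH => by simpa using A.rk_mono hH⟩
    obtain ⟨i, hiG, hiF⟩ := A.exists_sep h
    obtain ⟨F', hFF', hiF', hrk, hmin⟩ := A.adjoin F i hiF
    have hF'G := hmin G h.le hiG
    have := A.rk_lt h
    obtain ⟨b, hb, hcard, hle⟩ := IH _ (by omega) hF'G rfl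
    have hib : i ∉ b := fun hi => (hb i hi).2 hiF'
    refine ⟨insert i b, ?_, ?_, ?_⟩
    · intro j hj
      rcases Finset.mem_insert.1 hj with rfl | hj
      · exact ⟨hiG, hiF⟩
      · exact ⟨(hb j hj).1, fun hjF => (hb j hj).2 (A.mem_mono hFF'.le hjF)⟩
    · rw [Finset.card_insert_of_notMem hib]
      omega
    · intro H hFH
      rw [Finset.filter_insert]
      split_ifs with hiH
      · have h1 := hle H (hmin H hFH hiH)
        have h2 := Finset.card_insert_le i (b.filter fun i => A.mem i H)
        omega
      · obtain ⟨H', hHH', hiH', hrk', -⟩ := A.adjoin H i hiH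
        have h1 := hle H' (hmin H' (hFH.trans hHH'.le) hiH')
        have h2 : (b.filter fun i => A.mem i H).card ≤ (b.filter fun i => A.mem i H').card :=
          Finset.card_le_card fun j hj => by
            rw [Finset.mem_filter] at hj ⊢
            exact ⟨hj.1, A.mem_mono hHH'.le hj.2⟩
        omega

theorem sum_ind_eq (b : Finset E) (H : L) [DecidablePred fun i => A.mem i H] :
    ∑ i ∈ b, A.ind ℝ i H = (b.filter fun i => A.mem i H).card := by
  simp only [ind]
  rw [Finset.card_filter, Nat.cast_sum]
  refine Finset.sum_congr rfl fun i _ => ?_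
  split_ifs <;> simp

theorem ample_of_concave (g : ℕ → ℝ) (hmono : Monotone g)
    (hconc : ∀ r t s : ℕ, r < t → t < s → ((t : ℝ) - r) * (g s - g r) < (s - r) * (g t - g r)) :
    A.Ample fun H => g (A.rk H) := by
  classical
  intro F G h
  have hr := A.rk_lt h
  obtain ⟨b, hb, hcard, hle⟩ := A.exists_basis h.le
  have hcard' : (b.card : ℝ) + A.rk F = A.rk G := by exact_mod_cast hcard
  have hpos : (0 : ℝ) < A.rk G - A.rk F := by
    rw [sub_pos]
    exact_mod_cast hr
  refine ⟨b, g (A.rk F), (g (A.rk G) - g (A.rk F)) / (A.rk G - A.rk F), ?_, ?_, ?_⟩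
  · rw [Finset.sum_eq_zero fun i hi => A.ind_of_notMem (hb i hi).2]
    ring
  · rw [Finset.sum_congr rfl fun i hi => A.ind_of_mem (hb i hi).1]
    rw [Finset.sum_const, nsmul_eq_mul, mul_one, eq_sub_of_add_eq hcard',
      mul_div_cancel₀ _ hpos.ne']
    ring
  · intro H hFH hHG
    rw [sum_ind_eq]
    have h1 := hle H hFH.le
    have h1' : ((b.filter fun i => A.mem i H).card : ℝ) ≤ A.rk H - A.rk F := by
      rw [le_sub_iff_add_le]
      exact_mod_cast h1
    have h2 := hconc _ _ _ (A.rk_lt hFH) (A.rk_lt hHG)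
    have h3 : 0 ≤ g (A.rk G) - g (A.rk F) := sub_nonneg.2 (hmono hr.le)
    have h4 := mul_le_mul_of_nonneg_right h1' (div_nonneg h3 hpos.le)
    have h5 : ((A.rk H : ℝ) - A.rk F) * ((g (A.rk G) - g (A.rk F)) / (A.rk G - A.rk F))
        < g (A.rk H) - g (A.rk F) := by
      rw [← mul_div_assoc, div_lt_iff₀ hpos]
      linarith
    linarith

/-- A strictly concave increasing function converging, as `e` goes to zero, to minus the indicator
function of `0`. -/
noncomputable def concaveWeight (e : ℝ) (k : ℕ) : ℝ :=
  -(if k = 0 then 1 else 0) - e * (1 / ((k : ℝ) + 1))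

theorem concaveWeight_mono {e : ℝ} (he : 0 ≤ e) : Monotone (concaveWeight e) := by
  apply monotone_nat_of_le_succ
  intro k
  have h1 : 1 / (((k + 1 : ℕ) : ℝ) + 1) ≤ 1 / ((k : ℝ) + 1) := by
    push_cast
    apply one_div_le_one_div_of_le <;> linarith [(Nat.cast_nonneg k : (0 : ℝ) ≤ k)]
  have h2 := mul_le_mul_of_nonneg_left h1 he
  unfold concaveWeight
  rw [if_neg (Nat.succ_ne_zero k)]
  split_ifs <;> linarith

theorem concaveWeight_concave {e : ℝ} (he : 0 < e) (r t s : ℕ) (h1 : r < t) (h2 : t < s) :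
    ((t : ℝ) - r) * (concaveWeight e s - concaveWeight e r)
      < (s - r) * (concaveWeight e t - concaveWeight e r) := by
  have h1' : (r : ℝ) < t := by exact_mod_cast h1
  have h2' : (t : ℝ) < s := by exact_mod_cast h2
  have h0 : (0 : ℝ) ≤ r := Nat.cast_nonneg r
  have hd : ∀ u : ℕ, r < u → concaveWeight e u - concaveWeight e r
      = (if r = 0 then 1 else 0) + (u - r) * (e / ((u + 1) * (r + 1))) := by
    intro u hu
    have : ((u : ℝ) + 1) ≠ 0 := by positivity
    have : ((r : ℝ) + 1) ≠ 0 := by positivity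
    rw [concaveWeight, concaveWeight, if_neg (by omega : u ≠ 0)]
    field_simp
    ring
  rw [hd s (h1.trans h2), hd t h1]
  have h3 : e / (((s : ℝ) + 1) * (r + 1)) < e / ((t + 1) * (r + 1)) := by
    apply div_lt_div_of_pos_left he (by positivity)
    apply mul_lt_mul_of_pos_right <;> linarith
  have h4 : (0 : ℝ) ≤ if r = 0 then 1 else 0 := by split_ifs <;> norm_num
  have h5 := mul_lt_mul_of_pos_left h3 (mul_pos (sub_pos.2 h1') (sub_pos.2 (h1'.trans h2')))
  nlinarith

theorem tendsto_concaveWeight (k : ℕ) : Filter.Tendsto (fun e => concaveWeight e k)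
    (nhdsWithin 0 (Set.Ioi 0)) (nhds (-(if k = 0 then 1 else 0))) := by
  have h : Continuous fun e => concaveWeight e k := by
    unfold concaveWeight
    fun_prop
  have h1 := (h.tendsto 0).mono_left (nhdsWithin_le_nhds (s := Set.Ioi (0 : ℝ)))
  simpa [concaveWeight] using h1

section Limit
variable [Nonempty E] [Fintype L]

/-- The Lorentzian inequality at the boundary class supported at the bottom. -/
theorem deg_mul_val2_le_limit {F G : L} (h : F < G) (h2 : A.rk F + 2 ≤ A.rk G) (y : L → ℝ) :
    let v : L → ℝ := fun H => -(if A.rk H = 0 then 1 else 0)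
    A.deg F G * A.val v F G * A.val2 v F G y ≤ (A.deg F G - 1) * A.val1 v F G y ^ 2 := by
  intro v
  have hev : ∀ p : MvPolynomial L ℝ, Filter.Tendsto
      (fun e => MvPolynomial.eval (fun H => concaveWeight e (A.rk H)) p)
      (nhdsWithin 0 (Set.Ioi 0)) (nhds (MvPolynomial.eval v p)) := fun p =>
    (p.continuous_eval.tendsto v).comp (tendsto_pi_nhds.2 fun H => tendsto_concaveWeight (A.rk H))
  refine le_of_tendsto_of_tendsto (((hev _).const_mul _).mul (hev _))
    (((hev _).pow 2).const_mul _) ?_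
  filter_upwards [self_mem_nhdsWithin] with e he
  exact A.deg_mul_val2_le (A.ample_of_concave _ (concaveWeight_mono (le_of_lt he))
    (concaveWeight_concave he)) h h2 y

end Limit
end FlatLattice

namespace FlatLattice

variable {E L : Type} [PartialOrder L] (A : FlatLattice E L)
section Boundary
variable [Nonempty E] [Fintype L] (v : L → ℝ)

theorem val1_eq_at {F G : L} (h : F < G) {i : E} (hi : A.mem i G) (hi' : ¬ A.mem i F)
    (y : L → ℝ) : A.val1 v F G y = ∑ H, (y H - A.ind _ i H * y G - (1 - A.ind _ i H) * y F) *
      (A.val v F H * A.val v H G) := by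
  rw [val1, (A.indep F G).dvol_eq hi hi' h]
  simp [dvolAt, map_sum, eval_ind, val]

theorem val2_eq_at {F G : L} (h : F < G) {i : E} (hi : A.mem i G) (hi' : ¬ A.mem i F)
    (y : L → ℝ) : A.val2 v F G y = ∑ H, (y H - A.ind _ i H * y G - (1 - A.ind _ i H) * y F) *
      (A.val1 v F H y * A.val v H G + A.val v F H * A.val1 v H G y) := by
  set z : L → ℝ := fun H => y H - (y F + (∑ j ∈ {i}, A.ind _ j H) * (y G - y F)) with hz
  have hzF : z F = 0 := by simp [hz, A.ind_of_notMem hi']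
  have hzG : z G = 0 := by simp [hz, A.ind_of_mem hi]
  have hz1 : ∀ F G, A.val1 v F G z = A.val1 v F G y := fun F' G' =>
    A.val1_sub_sum_ind v F' G' y _ _ _
  have h1 : ∀ H, A.val1 v F H y * A.val v H G + A.val v F H * A.val1 v H G y
      = ∑ K, A.hessVal v F G H K * z K := by
    intro H
    rw [A.sum_hessVal_mul v H hzF hzG, hz1, hz1]
  have h2 : ∀ H, A.val1 v F H y * A.val v H G + A.val v F H * A.val1 v H G y
      = ∑ K, A.hessVal v F G H K * A.normalize F G y K := by
    intro H
    rw [A.sum_hessVal_mul v H (A.normalize_bot h y) (A.normalize_top h y), val1_normalize,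
      val1_normalize]
  have h3 : ∀ H, y H - A.ind _ i H * y G - (1 - A.ind _ i H) * y F = z H := by
    intro H
    simp only [hz, Finset.sum_singleton]
    ring
  rw [← A.val2_normalize v h, A.val2_eq_of_zero v (A.normalize_bot h y) (A.normalize_top h y)]
  simp only [val1_normalize, h3]
  rw [Finset.sum_congr rfl fun H _ => congrArg (A.normalize F G y H * ·) (h1 H),
    Finset.sum_congr rfl fun H _ => congrArg (z H * ·) (h2 H)]
  simp only [Finset.mul_sum]
  rw [Finset.sum_comm]
  refine Finset.sum_congr rfl fun H _ => Finset.sum_congr rfl fun K _ => ?_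
  rw [hessVal, hess_symm, ← hessVal]
  ring

theorem sum_ind_mul_val_two {F G : L} (h : F < G) (h2 : A.rk G = A.rk F + 2) {i : E}
    (hi : A.mem i G) (hi' : ¬ A.mem i F) :
    ∑ H, A.ind ℝ i H * (A.val v F H * A.val v H G) = 1 := by
  have := congrArg (MvPolynomial.eval v) (A.rk_two_sum F G h h2 hi hi')
  simpa [starSum, map_sum, eval_ind, val] using this

/-- The boundary class supported at the flats of rank zero. -/
def botClass (H : L) : ℝ := -(if A.rk H = 0 then 1 else 0)

theorem val_botClass_eq_zero {K H : L} (hK : A.rk K ≠ 0) (hr : A.rk H ≠ A.rk K + 1) :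
    A.val A.botClass K H = 0 := by
  by_cases h : K < H
  swap
  · exact A.val_of_not_lt _ h
  have h' := A.rk_lt h
  have hd : A.deg K H ≠ 0 := by linarith [A.one_le_deg (F := K) (G := H) (by omega)]
  refine (mul_eq_zero.1 ?_).resolve_left hd
  rw [A.deg_mul_val _ h, val1_eq, Finset.sum_eq_zero]
  intro J _
  by_cases hJ : K < J ∧ J < H
  · have h1 := A.rk_lt hJ.1
    have hJ0 : A.rk J ≠ 0 := by omega
    have hH0 : A.rk H ≠ 0 := by omega
    simp [botClass, hK, hJ0, hH0]
  · rw [A.val_mul_val_eq_zero hJ, mul_zero]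

open Classical in
theorem val_mul_val_botClass (F : L) {K H : L} (hK : A.rk K ≠ 0) :
    A.val A.botClass F K * A.val A.botClass K H
      = if K < H ∧ A.rk K + 1 = A.rk H then A.val A.botClass F K else 0 := by
  split_ifs with h
  · rw [A.val_of_rk_le _ h.1 h.2.ge, mul_one]
  · by_cases hlt : K < H
    · rw [A.val_botClass_eq_zero hK fun h2 => h ⟨hlt, h2.symm⟩, mul_zero]
    · rw [A.val_of_not_lt _ hlt, mul_zero]

/-- A weight satisfying the recursion of the Möbius invariants of the flats. -/
structure IsMobius (m : L → ℝ) : Prop where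
  one : ∀ H, A.rk H = 1 → m H = 1
  recursion : ∀ H, 2 ≤ A.rk H → ∀ i, A.mem i H → ∀ F, A.rk F = 0 → F < H → ¬ A.mem i F →
    m H = ∑ K, open Classical in
      if K < H ∧ A.rk K + 1 = A.rk H ∧ ¬ A.mem i K then m K else 0

variable {A} in
theorem IsMobius.factorial_mul_val {m : L → ℝ} (hm : A.IsMobius m) {F : L} (hF : A.rk F = 0)
    (hbot : ∀ H, F ≤ H) {H : L} (hFH : F < H) :
    ((A.rk H - 1).factorial : ℝ) * A.val A.botClass F H = m H := by
  induction hn : A.rk H using Nat.strong_induction_on generalizing H with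
  | _ n IH =>
    subst hn
    have h0 := A.rk_lt hFH
    by_cases h1 : A.rk H = 1
    · rw [hm.one H h1, A.val_of_rk_le _ hFH (by omega), h1]
      simp
    obtain ⟨i, hi, hi'⟩ := A.exists_sep hFH
    have hd : (((A.rk H - 1).factorial : ℕ) : ℝ)
        = ((A.rk H - 2).factorial : ℝ) * A.deg F H := by
      rw [show A.rk H - 1 = (A.rk H - 2) + 1 by omega, Nat.factorial_succ, deg, hF]
      push_cast [show 2 ≤ A.rk H by omega]
      ring
    rw [hd, mul_assoc, A.deg_mul_val _ hFH, A.val1_eq_at _ hFH hi hi',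
      hm.recursion H (by omega) i hi F hF hFH hi', Finset.mul_sum]
    refine Finset.sum_congr rfl fun K _ => ?_
    rcases (hbot K).eq_or_lt with rfl | hFK
    · rw [A.val_of_not_lt _ (lt_irrefl _), if_neg (by omega)]
      ring
    have hK0 : A.rk K ≠ 0 := by
      have := A.rk_lt hFK
      omega
    have hH0 : A.rk H ≠ 0 := by omega
    rw [A.val_mul_val_botClass F hK0]
    by_cases hK : K < H ∧ A.rk K + 1 = A.rk H
    · rw [if_pos hK]
      have h2 := IH (A.rk K) (by omega) hFK rfl
      rw [show A.rk K - 1 = A.rk H - 2 by omega] at h2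
      by_cases hiK : A.mem i K
      · rw [if_neg (by tauto), A.ind_of_mem hiK]
        simp [botClass, hK0, hH0]
      · rw [if_pos (by tauto), A.ind_of_notMem hiK, ← h2]
        simp [botClass, hF, hK0]
    · rw [if_neg hK, if_neg (by tauto)]
      ring

open Classical in
variable {A} in
theorem IsMobius.log_concave {m : L → ℝ} (hm : A.IsMobius m) {F G : L} (hF : A.rk F = 0)
    (hbot : ∀ H, F ≤ H) (htop : ∀ H, H ≤ G) (h3 : 3 ≤ A.rk G) {i : E} (hi : A.mem i G)
    (hi' : ¬ A.mem i F) :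
    m G * (∑ H, if A.mem i H ∧ A.rk H + 2 = A.rk G then m H else 0)
      ≤ (∑ H, if A.mem i H ∧ A.rk H + 1 = A.rk G then m H else 0) ^ 2 := by
  have hFG : F < G := by
    refine lt_of_le_of_ne (hbot G) ?_
    rintro rfl
    omega
  have hlt : ∀ H, A.rk H ≠ A.rk G → H < G := fun H hH =>
    lt_of_le_of_ne (htop H) fun h => hH (congrArg A.rk h)
  set y : L → ℝ := fun H => if H = G then -1 else 0 with hy
  have hineq := A.deg_mul_val2_le_limit hFG (by omega) y
  change A.deg F G * A.val A.botClass F G * A.val2 A.botClass F G y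
    ≤ (A.deg F G - 1) * A.val1 A.botClass F G y ^ 2 at hineq
  have hyn : ∀ H, F < H ∧ H < G → ∀ j, y H - A.ind _ j H * y G - (1 - A.ind _ j H) * y F
      = A.ind _ j H := by
    intro H hH j
    simp [hy, hH.2.ne, hFG.ne]
  have h1 : ((A.rk G - 2).factorial : ℝ) * A.val1 A.botClass F G y
      = ∑ H, if A.mem i H ∧ A.rk H + 1 = A.rk G then m H else 0 := by
    rw [A.val1_eq_at _ hFG hi hi', Finset.mul_sum]
    refine Finset.sum_congr rfl fun H _ => ?_
    by_cases hH : F < H ∧ H < G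
    · have h4 := A.rk_lt hH.1
      rw [hyn H hH, A.val_mul_val_botClass F (by omega : A.rk H ≠ 0)]
      by_cases hiH : A.mem i H
      · by_cases hr : A.rk H + 1 = A.rk G
        · rw [if_pos ⟨hH.2, hr⟩, if_pos ⟨hiH, hr⟩, A.ind_of_mem hiH, one_mul,
            ← hm.factorial_mul_val hF hbot hH.1, show A.rk H - 1 = A.rk G - 2 by omega]
        · rw [if_neg (by tauto), if_neg (by tauto)]
          ring
      · rw [if_neg (fun h : _ ∧ _ => hiH h.1), A.ind_of_notMem hiH]
        ring
    · rw [A.val_mul_val_eq_zero hH, if_neg]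
      · ring
      · rintro ⟨hiH, hr⟩
        refine hH ⟨lt_of_le_of_ne (hbot H) ?_, hlt H (by omega)⟩
        rintro rfl
        exact hi' hiH
  have h2 : ((A.rk G - 3).factorial : ℝ) * A.val2 A.botClass F G y
      = ∑ H, if A.mem i H ∧ A.rk H + 2 = A.rk G then m H else 0 := by
    rw [A.val2_eq_at _ hFG hi hi', Finset.mul_sum]
    refine Finset.sum_congr rfl fun H _ => ?_
    by_cases hH : F < H ∧ H < G
    · have h4 := A.rk_lt hH.1
      have h5 := A.rk_lt hH.2
      have h6 : A.val1 A.botClass F H y = 0 := by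
        rw [val1_eq, Finset.sum_eq_zero]
        intro K _
        by_cases hK : F < K ∧ K < H
        · simp [hy, (hK.2.trans hH.2).ne, hH.2.ne, hFG.ne]
        · rw [A.val_mul_val_eq_zero hK, mul_zero]
      have h7 : A.val1 A.botClass H G y = if A.rk H + 2 = A.rk G then 1 else 0 := by
        have h8 : A.val1 A.botClass H G y = ∑ K, A.ind ℝ (A.sep H G) K *
            (A.val A.botClass H K * A.val A.botClass K G) := by
          rw [val1_eq]
          refine Finset.sum_congr rfl fun K _ => ?_
          by_cases hK : H < K ∧ K < G
          · simp [hy, hK.2.ne, hH.2.ne]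
          · rw [A.val_mul_val_eq_zero hK, mul_zero, mul_zero]
        rw [h8]
        split_ifs with hr
        · exact A.sum_ind_mul_val_two _ hH.2 hr.symm (A.sep_mem hH.2) (A.sep_notMem hH.2)
        · rw [Finset.sum_eq_zero]
          intro K _
          by_cases hK : A.rk K = A.rk H + 1
          · rw [A.val_botClass_eq_zero (K := K) (by omega) (by omega)]
            ring
          · rw [A.val_botClass_eq_zero (K := H) (by omega) (by omega)]
            ring
      rw [hyn H hH, h6, h7]
      by_cases hiH : A.mem i H
      · by_cases hr : A.rk H + 2 = A.rk G
        · rw [if_pos hr, if_pos ⟨hiH, hr⟩, A.ind_of_mem hiH,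
            ← hm.factorial_mul_val hF hbot hH.1, show A.rk H - 1 = A.rk G - 3 by omega]
          ring
        · rw [if_neg hr, if_neg (by tauto)]
          ring
      · rw [if_neg (fun h : _ ∧ _ => hiH h.1), A.ind_of_notMem hiH]
        ring
    · rw [if_neg]
      · by_cases hF' : F < H
        · have hG' : ¬ H < G := fun h => hH ⟨hF', h⟩
          simp [A.val_of_not_lt _ hG', A.val1_of_not_lt _ hG']
        · simp [A.val_of_not_lt _ hF', A.val1_of_not_lt _ hF']
      · rintro ⟨hiH, hr⟩
        refine hH ⟨lt_of_le_of_ne (hbot H) ?_, hlt H (by omega)⟩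
        rintro rfl
        exact hi' hiH
  rw [← h1, ← h2, ← hm.factorial_mul_val hF hbot hFG]
  obtain ⟨k, hk⟩ : ∃ k, A.rk G = k + 3 := ⟨A.rk G - 3, by omega⟩
  have hdeg : A.deg F G = k + 2 := by
    rw [deg, hk, hF]
    push_cast
    ring
  rw [hdeg] at hineq
  rw [hk, show k + 3 - 1 = (k + 1) + 1 by omega, show k + 3 - 2 = k + 1 by omega,
    show k + 3 - 3 = k by omega, Nat.factorial_succ (k + 1), Nat.factorial_succ k]
  push_cast
  have hpos : (0 : ℝ) ≤ (k + 1) * (k.factorial : ℝ) ^ 2 := by positivity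
  have := mul_le_mul_of_nonneg_left hineq hpos
  nlinarith

end Boundary
end FlatLattice

/-- The rank function of a loopless matroid. -/
structure RankFn (J : Type) [DecidableEq J] where
  r : Finset J → ℕ
  empty : r ∅ = 0
  singleton : ∀ i, r {i} = 1
  mono : ∀ {B C}, B ⊆ C → r B ≤ r C
  submod : ∀ B C, r (B ∪ C) + r (B ∩ C) ≤ r B + r C

namespace RankFn

variable {J : Type} [DecidableEq J] (M : RankFn J)

theorem insert_le (i : J) (B : Finset J) : M.r (insert i B) ≤ M.r B + 1 := by
  have h := M.submod {i} B
  rw [M.singleton, ← Finset.insert_eq] at h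
  omega

theorem insert_submod {B C : Finset J} (h : B ⊆ C) (i : J) :
    M.r (insert i C) + M.r B ≤ M.r (insert i B) + M.r C := by
  have h1 := M.submod (insert i B) C
  have h2 : insert i B ∪ C = insert i C := by
    rw [Finset.insert_union, Finset.union_eq_right.2 h]
  have h3 : M.r B ≤ M.r (insert i B ∩ C) :=
    M.mono (Finset.subset_inter (Finset.subset_insert i B) h)
  rw [h2] at h1
  omega

variable [Fintype J]

/-- The closure of a set. -/
def cl (B : Finset J) : Finset J := Finset.univ.filter fun i => M.r (insert i B) = M.r B

theorem mem_cl {i : J} {B : Finset J} : i ∈ M.cl B ↔ M.r (insert i B) = M.r B := by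
  simp [cl]

theorem subset_cl (B : Finset J) : B ⊆ M.cl B := by
  intro i hi
  rw [mem_cl, Finset.insert_eq_of_mem hi]

theorem cl_mono {B C : Finset J} (h : B ⊆ C) : M.cl B ⊆ M.cl C := by
  intro i hi
  rw [mem_cl] at hi ⊢
  have h1 := M.insert_submod h i
  have h2 := M.mono (Finset.subset_insert i C)
  omega

theorem r_cl (B : Finset J) : M.r (M.cl B) = M.r B := by
  have h : ∀ S, S ⊆ M.cl B → M.r (S ∪ B) = M.r B := by
    intro S
    induction S using Finset.induction_on with
    | empty => simp
    | insert i S _ ih =>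
      intro hS
      rw [Finset.insert_subset_iff, mem_cl] at hS
      have h1 := M.insert_submod (Finset.subset_union_right : B ⊆ S ∪ B) i
      have h2 := M.mono (Finset.subset_insert i (S ∪ B))
      have h3 := ih hS.2
      rw [Finset.insert_union]
      omega
  have := h _ subset_rfl
  rwa [Finset.union_eq_left.2 (M.subset_cl B)] at this

theorem cl_cl (B : Finset J) : M.cl (M.cl B) = M.cl B := by
  refine Finset.Subset.antisymm (fun i hi => ?_) (M.subset_cl _)
  rw [mem_cl, r_cl] at hi
  rw [mem_cl]
  have h1 := M.mono (Finset.insert_subset_insert i (M.subset_cl B))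
  have h2 := M.mono (Finset.subset_insert i B)
  omega

/-- The flats of the matroid. -/
abbrev Flat := {F : Finset J // M.cl F = F}

theorem r_lt_insert {F : M.Flat} {i : J} (hi : i ∉ F.1) : M.r (insert i F.1) = M.r F.1 + 1 := by
  rw [← F.2, mem_cl] at hi
  have h1 := M.insert_le i F.1
  have h2 := M.mono (Finset.subset_insert i F.1)
  omega

theorem r_lt {F G : M.Flat} (h : F < G) : M.r F.1 < M.r G.1 := by
  obtain ⟨i, hiG, hiF⟩ := Finset.exists_of_ssubset (show F.1 ⊂ G.1 from h)
  have h1 := M.r_lt_insert hiF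
  have h2 := M.mono (Finset.insert_subset hiG (show F.1 ⊆ G.1 from h.le))
  omega

/-- The lattice of flats. -/
def flatLattice : FlatLattice J M.Flat where
  mem i F := i ∈ F.1
  rk F := M.r F.1
  le_iff _ _ := Iff.rfl
  rk_lt h := M.r_lt h
  adjoin F i hi := by
    refine ⟨⟨M.cl (insert i F.1), M.cl_cl _⟩, ?_, ?_, ?_, ?_⟩
    · have hsub : F.1 ⊆ M.cl (insert i F.1) :=
        (Finset.subset_insert i F.1).trans (M.subset_cl _)
      refine lt_of_le_of_ne hsub fun h => hi ?_
      rw [h]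
      exact M.subset_cl _ (Finset.mem_insert_self i F.1)
    · exact M.subset_cl _ (Finset.mem_insert_self i F.1)
    · rw [r_cl, M.r_lt_insert hi]
    · intro K hFK hiK
      have h := M.cl_mono (Finset.insert_subset hiK hFK)
      rw [K.2] at h
      exact h

/-- The absolute value of the Möbius invariant of a flat, as a sum over its spanning sets. -/
def mobius (F : M.Flat) : ℤ :=
  (-1) ^ M.r F.1 * ∑ B with M.cl B = F.1, (-1) ^ B.card

theorem r_eq_of_cl_eq {B : Finset J} {F : M.Flat} (h : M.cl B = F.1) : M.r B = M.r F.1 := by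
  rw [← h, r_cl]

theorem cl_insert_eq_iff {F : M.Flat} {i : J} (hi : i ∈ F.1) (B : Finset J) :
    (M.cl (insert i B) = F.1 ∧ M.cl B ≠ F.1) ↔
      (M.cl B ⊂ F.1 ∧ M.r B + 1 = M.r F.1 ∧ i ∉ M.cl B) := by
  constructor
  · rintro ⟨h1, h2⟩
    have hsub : M.cl B ⊂ F.1 :=
      Finset.ssubset_iff_subset_ne.2 ⟨h1 ▸ M.cl_mono (Finset.subset_insert i B), h2⟩
    have h3 := M.r_lt (F := ⟨M.cl B, M.cl_cl B⟩) (G := F) hsub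
    simp only [r_cl] at h3
    have h4 := M.r_eq_of_cl_eq h1
    have h5 := M.insert_le i B
    refine ⟨hsub, by omega, ?_⟩
    rw [mem_cl]
    omega
  · rintro ⟨h1, h2, h3⟩
    refine ⟨?_, h1.ne⟩
    rw [mem_cl] at h3
    have h4 := M.insert_le i B
    have h5 := M.mono (Finset.subset_insert i B)
    have h6 : M.cl (insert i B) ⊆ F.1 := by
      have := M.cl_mono (Finset.insert_subset hi ((M.subset_cl B).trans h1.subset))
      rwa [F.2] at this
    by_contra hne
    have h7 := M.r_lt (F := ⟨M.cl (insert i B), M.cl_cl _⟩) (G := F)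
      (Finset.ssubset_iff_subset_ne.2 ⟨h6, hne⟩)
    simp only [r_cl] at h7
    omega

theorem sum_toggle (f : Finset J → ℤ) (i : J) :
    ∑ B, f B = ∑ B with i ∉ B, (f B + f (insert i B)) := by
  rw [Finset.sum_add_distrib, ← Finset.sum_filter_not_add_sum_filter _ (fun B => i ∈ B)]
  congr 1
  refine Finset.sum_nbij' (fun B => B.erase i) (fun B => insert i B) ?_ ?_ ?_ ?_ ?_
  · intro B _
    simp
  · intro B _
    simp
  · intro B hB
    exact Finset.insert_erase (by simpa using hB)
  · intro B hB
    exact Finset.erase_insert (by simpa using hB)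
  · intro B hB
    rw [Finset.insert_erase (by simpa using hB)]

theorem mobius_recursion {F : M.Flat} {i : J} (hi : i ∈ F.1) :
    M.mobius F
      = ∑ K : M.Flat, if K < F ∧ M.r K.1 + 1 = M.r F.1 ∧ i ∉ K.1 then M.mobius K else 0 := by
  classical
  have h1 : ∑ B with M.cl B = F.1, (-1 : ℤ) ^ B.card
      = - ∑ B, if M.cl B ⊂ F.1 ∧ M.r B + 1 = M.r F.1 ∧ i ∉ M.cl B then
          (-1 : ℤ) ^ B.card else 0 := by
    rw [Finset.sum_filter, sum_toggle _ i, Finset.sum_filter, ← Finset.sum_neg_distrib]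
    refine Finset.sum_congr rfl fun B _ => ?_
    simp only [← M.cl_insert_eq_iff hi]
    by_cases hiB : i ∈ B
    · rw [if_neg (by simpa using hiB), if_neg, neg_zero]
      rw [Finset.insert_eq_of_mem hiB]
      tauto
    · rw [if_pos hiB, Finset.card_insert_of_notMem hiB, pow_succ]
      by_cases h2 : M.cl B = F.1
      · have h3 : M.cl (insert i B) = F.1 := by
          refine Finset.Subset.antisymm ?_ (h2 ▸ M.cl_mono (Finset.subset_insert i B))
          have := M.cl_mono (Finset.insert_subset hi (h2 ▸ M.subset_cl B))
          rwa [F.2] at this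
        simp [h2, h3]
      · by_cases h3 : M.cl (insert i B) = F.1
        · simp [h2, h3]
        · simp [h2, h3]
  have h2 : ∀ B, (if M.cl B ⊂ F.1 ∧ M.r B + 1 = M.r F.1 ∧ i ∉ M.cl B then
        (-1 : ℤ) ^ B.card else 0)
      = ∑ K : M.Flat, if K < F ∧ M.r K.1 + 1 = M.r F.1 ∧ i ∉ K.1 then
        (if M.cl B = K.1 then (-1 : ℤ) ^ B.card else 0) else 0 := by
    intro B
    rw [Finset.sum_eq_single ⟨M.cl B, M.cl_cl B⟩]
    · simp only [r_cl, if_true]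
      rfl
    · intro K _ hK
      have : M.cl B ≠ K.1 := fun h => hK (Subtype.ext h.symm)
      simp [this]
    · simp
  rw [mobius, h1, Finset.sum_congr rfl fun B _ => h2 B, Finset.sum_comm, ← Finset.sum_neg_distrib,
    Finset.mul_sum]
  refine Finset.sum_congr rfl fun K _ => ?_
  split_ifs with hK
  · rw [mobius, ← hK.2.1, Finset.sum_filter, pow_succ]
    ring
  · simp

/-- The bottom flat. -/
def bot : M.Flat := ⟨∅, by
  ext i
  rw [mem_cl, M.empty]
  simp [M.singleton]⟩

/-- The top flat. -/
def top : M.Flat := ⟨Finset.univ, Finset.univ_subset_iff.1 (M.subset_cl _)⟩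

theorem eq_bot {F : M.Flat} (h : M.r F.1 = 0) : F = M.bot := by
  apply Subtype.ext
  by_contra hne
  have := M.r_lt (F := M.bot) (G := F) (Finset.ssubset_iff_subset_ne.2
    ⟨Finset.empty_subset _, Ne.symm hne⟩)
  omega

theorem mobius_bot : M.mobius M.bot = 1 := by
  have h : ∀ B, M.cl B = M.bot.1 ↔ B = ∅ := by
    intro B
    constructor
    · intro h
      have hB := M.subset_cl B
      rw [h] at hB
      exact Finset.subset_empty.1 hB
    · rintro rfl
      exact M.bot.2
  simp only [mobius, h]
  simp [bot, M.empty, Finset.filter_eq']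

theorem exists_mem {F : M.Flat} (h : M.r F.1 ≠ 0) : ∃ i, i ∈ F.1 := by
  by_contra! hc
  rw [Finset.eq_empty_of_forall_notMem hc, M.empty] at h
  exact h rfl

theorem mobius_nonneg (F : M.Flat) : 0 ≤ M.mobius F := by
  induction hn : M.r F.1 using Nat.strong_induction_on generalizing F with
  | _ n IH =>
    subst hn
    by_cases h : M.r F.1 = 0
    · rw [M.eq_bot h, mobius_bot]
      exact zero_le_one
    obtain ⟨i, hi⟩ := M.exists_mem h
    rw [M.mobius_recursion hi]
    refine Finset.sum_nonneg fun K _ => ?_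
    split_ifs with hK
    · exact IH _ (by omega) K rfl
    · exact le_rfl

theorem isMobius : M.flatLattice.IsMobius fun F => (M.mobius F : ℝ) where
  one F hF := by
    change M.r F.1 = 1 at hF
    obtain ⟨i, hi⟩ := M.exists_mem (F := F) (by omega)
    rw [M.mobius_recursion hi, Finset.sum_eq_single M.bot, if_pos, mobius_bot, Int.cast_one]
    · refine ⟨Finset.ssubset_iff_subset_ne.2 ⟨Finset.empty_subset _, fun h => ?_⟩, ?_, ?_⟩
      · rw [← h] at hi
        exact absurd hi (Finset.notMem_empty i)
      · rw [hF]
        change M.r ∅ + 1 = 1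
        rw [M.empty]
      · exact Finset.notMem_empty i
    · intro K _ hK
      rw [if_neg]
      rintro ⟨-, h, -⟩
      exact hK (M.eq_bot (by omega))
    · simp
  recursion F _ i hi _ _ _ _ := by
    rw [M.mobius_recursion hi]
    push_cast
    refine Finset.sum_congr rfl fun K _ => ?_
    by_cases hK : K < F ∧ M.r K.1 + 1 = M.r F.1 ∧ i ∉ K.1
    · exact (if_pos hK).trans (if_pos hK).symm
    · exact (if_neg hK).trans (if_neg hK).symm

theorem mobius_log_concave (h3 : 3 ≤ M.r Finset.univ) (i : J) :
    M.mobius M.top * (∑ F : M.Flat with i ∈ F.1 ∧ M.r F.1 + 2 = M.r Finset.univ, M.mobius F)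
      ≤ (∑ F : M.Flat with i ∈ F.1 ∧ M.r F.1 + 1 = M.r Finset.univ, M.mobius F) ^ 2 := by
  classical
  have : Nonempty J := ⟨i⟩
  have h := M.isMobius.log_concave (F := M.bot) (G := M.top) M.empty
    (fun H => Finset.empty_subset H.1) (fun H => Finset.subset_univ H.1) h3
    (Finset.mem_univ i) (Finset.notMem_empty i)
  have hc : ((M.mobius M.top * (∑ F : M.Flat with i ∈ F.1 ∧ M.r F.1 + 2 = M.r Finset.univ,
      M.mobius F) : ℤ) : ℝ) ≤ (((∑ F : M.Flat with i ∈ F.1 ∧ M.r F.1 + 1 = M.r Finset.univ,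
      M.mobius F) ^ 2 : ℤ) : ℝ) := by
    simp only [Finset.sum_filter]
    push_cast
    convert h <;> first | exact Iff.rfl | rfl
  exact_mod_cast hc

end RankFn

namespace RankFn

section Truncation

variable {J : Type} [DecidableEq J] (M : RankFn J)

/-- The truncation to rank `n` of the matroid obtained by adding a coloop. -/
def coloop (n : ℕ) (hn : 1 ≤ n) : RankFn (Option J) where
  r B := min (M.r B.eraseNone + if none ∈ B then 1 else 0) n
  empty := by simp [M.empty]
  singleton i := by
    cases i with
    | none => simpa [M.empty] using hn
    | some i =>
      have : Finset.eraseNone {some i} = {i} := by ext; simp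
      simpa [this, M.singleton] using hn
  mono {B C} h := by
    have h1 := M.mono (Finset.eraseNone.monotone h)
    have h2 : none ∈ B → none ∈ C := fun hB => h hB
    split_ifs <;> first | omega | tauto
  submod B C := by
    have h1 := M.submod B.eraseNone C.eraseNone
    have h2 := M.mono (Finset.inter_subset_left : B.eraseNone ∩ C.eraseNone ⊆ _)
    have h3 := M.mono (Finset.inter_subset_right : B.eraseNone ∩ C.eraseNone ⊆ _)
    have h4 := M.mono (Finset.subset_union_left : _ ⊆ B.eraseNone ∪ C.eraseNone)
    have h5 := M.mono (Finset.subset_union_right : _ ⊆ B.eraseNone ∪ C.eraseNone)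
    rw [Finset.eraseNone_union, Finset.eraseNone_inter]
    by_cases hB : none ∈ B <;> by_cases hC : none ∈ C <;>
      simp only [hB, hC, Finset.mem_union, Finset.mem_inter, or_self, or_true, true_or, and_self,
        and_true, and_false, if_true, if_false] <;> omega

variable {n : ℕ} (hn : 1 ≤ n)

theorem coloop_insertNone (B : Finset J) :
    (M.coloop n hn).r B.insertNone = min (M.r B + 1) n := by
  simp [coloop]

theorem coloop_map_some (B : Finset J) :
    (M.coloop n hn).r (B.map Function.Embedding.some) = min (M.r B) n := by
  simp [coloop]

variable [Fintype J]

/-- The absolute values of the coefficients of the characteristic polynomial. -/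
def whitney (j : ℕ) : ℤ := (-1) ^ j * ∑ B with M.r B = j, (-1) ^ B.card

theorem sum_mobius (p : Finset J → Prop) [DecidablePred p] (j : ℕ)
    (hp : ∀ B, M.r B = j → (p (M.cl B) ↔ p B)) :
    ∑ F : M.Flat with p F.1 ∧ M.r F.1 = j, M.mobius F
      = (-1) ^ j * ∑ B with p B ∧ M.r B = j, (-1) ^ B.card := by
  have h : ∀ B, (if p B ∧ M.r B = j then (-1 : ℤ) ^ B.card else 0)
      = ∑ F : M.Flat, if p F.1 ∧ M.r F.1 = j then
        (if M.cl B = F.1 then (-1 : ℤ) ^ B.card else 0) else 0 := by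
    intro B
    rw [Finset.sum_eq_single ⟨M.cl B, M.cl_cl B⟩]
    · simp only [r_cl, if_true]
      exact if_congr (and_congr_left fun hB => (hp B hB).symm) rfl rfl
    · intro F _ hF
      have : M.cl B ≠ F.1 := fun h => hF (Subtype.ext h.symm)
      simp [this]
    · simp
  rw [Finset.sum_filter, Finset.sum_filter, Finset.sum_congr rfl fun B _ => h B, Finset.sum_comm,
    Finset.mul_sum]
  refine Finset.sum_congr rfl fun F _ => ?_
  split_ifs with hF
  · rw [mobius, hF.2, Finset.sum_filter]
  · simp

theorem none_mem_cl_coloop {B : Finset (Option J)} (hB : (M.coloop n hn).r B < n) :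
    none ∈ (M.coloop n hn).cl B ↔ none ∈ B := by
  refine ⟨fun h => ?_, fun h => (M.coloop n hn).subset_cl B h⟩
  by_contra hc
  have he : (insert none B).eraseNone = B.eraseNone := by ext; simp
  rw [mem_cl] at h
  simp only [coloop, he, hc, Finset.mem_insert_self, if_true, if_false] at h hB
  omega

theorem sum_mobius_coloop_mem {j : ℕ} (hj : j + 1 < n) :
    ∑ F : (M.coloop n hn).Flat with none ∈ F.1 ∧ (M.coloop n hn).r F.1 = j + 1,
      (M.coloop n hn).mobius F = M.whitney j := by
  rw [sum_mobius _ (fun B => none ∈ B) _ fun B hB => M.none_mem_cl_coloop hn (by omega), whitney,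
    Finset.mul_sum, Finset.mul_sum]
  refine Finset.sum_nbij' (fun B => B.eraseNone) (fun B => B.insertNone) ?_ ?_ ?_ ?_ ?_
  · intro B hB
    obtain ⟨h1, h2⟩ := (Finset.mem_filter.1 hB).2
    simp only [coloop, h1, if_true] at h2
    simp only [Finset.mem_filter, Finset.mem_univ, true_and]
    omega
  · intro B hB
    simp only [Finset.mem_filter, Finset.mem_univ, true_and, coloop_insertNone] at hB ⊢
    refine ⟨by simp, by omega⟩
  · intro B hB
    simp only [Finset.mem_filter] at hB
    simp [Finset.insertNone_eraseNone, hB.2.1]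
  · intro B _
    simp
  · intro B hB
    simp only [Finset.mem_filter] at hB
    have h := Finset.card_insertNone B.eraseNone
    rw [Finset.insertNone_eraseNone, Finset.insert_eq_of_mem hB.2.1] at h
    rw [h, pow_succ, pow_succ]
    ring

theorem sum_mobius_coloop_notMem {j : ℕ} (hj : j < n) :
    ∑ F : (M.coloop n hn).Flat with none ∉ F.1 ∧ (M.coloop n hn).r F.1 = j,
      (M.coloop n hn).mobius F = M.whitney j := by
  rw [sum_mobius _ (fun B => none ∉ B) _ fun B hB =>
    not_congr (M.none_mem_cl_coloop hn (by omega)), whitney, Finset.mul_sum, Finset.mul_sum]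
  refine Finset.sum_nbij' (fun B => B.eraseNone) (fun B => B.map Function.Embedding.some)
    ?_ ?_ ?_ ?_ ?_
  · intro B hB
    obtain ⟨h1, h2⟩ := (Finset.mem_filter.1 hB).2
    simp only [coloop, h1, if_false] at h2
    simp only [Finset.mem_filter, Finset.mem_univ, true_and]
    omega
  · intro B hB
    simp only [Finset.mem_filter, Finset.mem_univ, true_and, coloop_map_some] at hB ⊢
    refine ⟨by simp, by omega⟩
  · intro B hB
    simp only [Finset.mem_filter] at hB
    simp [Finset.map_some_eraseNone, hB.2.1]
  · intro B _
    simp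
  · intro B hB
    simp only [Finset.mem_filter] at hB
    rw [Finset.card_eraseNone_of_not_mem hB.2.1]

theorem whitney_nonneg (j : ℕ) : 0 ≤ M.whitney j := by
  rw [← M.sum_mobius_coloop_notMem (n := j + 1) (by omega) (Nat.lt_succ_self j)]
  exact Finset.sum_nonneg fun F _ => mobius_nonneg _ F

theorem whitney_eq_zero {j : ℕ} (hj : ∀ B, M.r B ≠ j) : M.whitney j = 0 := by
  simp [whitney, hj]

theorem whitney_log_concave (j : ℕ) :
    M.whitney j * M.whitney (j + 2) ≤ M.whitney (j + 1) ^ 2 := by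
  by_cases hr : M.r Finset.univ < j + 2
  · rw [M.whitney_eq_zero (j := j + 2), mul_zero]
    · positivity
    · intro B
      have := M.mono (Finset.subset_univ B)
      omega
  have hn : 1 ≤ j + 3 := by omega
  set N := M.coloop (j + 3) hn with hN
  have hu : N.r Finset.univ = j + 3 := by
    have : (Finset.univ : Finset (Option J)).eraseNone = Finset.univ := by ext; simp
    simp only [hN, coloop, this, Finset.mem_univ, if_true]
    omega
  have htop : N.mobius N.top = M.whitney (j + 2) := by
    rw [N.mobius_recursion (i := none) (Finset.mem_univ _),
      ← M.sum_mobius_coloop_notMem hn (Nat.lt_succ_self (j + 2)), Finset.sum_filter]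
    refine Finset.sum_congr rfl fun F _ => if_congr ?_ rfl rfl
    have hT : N.r N.top.1 = j + 3 := hu
    rw [hT]
    constructor
    · rintro ⟨-, h1, h2⟩
      exact ⟨h2, show N.r F.1 = j + 2 by omega⟩
    · rintro ⟨h1, h2⟩
      have hF : N.r F.1 = j + 2 := h2
      refine ⟨Finset.ssubset_iff_subset_ne.2 ⟨Finset.subset_univ _, fun h => ?_⟩, by omega, h1⟩
      exact h1 (h ▸ Finset.mem_univ _)
  have h := N.mobius_log_concave (by omega) none
  rw [htop, hu] at h
  simp only [show ∀ m, m + 2 = j + 3 ↔ m = j + 1 by omega,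
    show ∀ m, m + 1 = j + 3 ↔ m = j + 1 + 1 by omega] at h
  rw [M.sum_mobius_coloop_mem hn (by omega), M.sum_mobius_coloop_mem hn (by omega)] at h
  linarith

end Truncation

end RankFn

/-- The rank function of a finite family of nonzero vectors. -/
noncomputable def vectorRank {K V I : Type} [Field K] [AddCommGroup V] [Module K V]
    [FiniteDimensional K V] [DecidableEq I] (v : I → V) (hv : ∀ i, v i ≠ 0) : RankFn I where
  r B := Module.finrank K (Submodule.span K (v '' B))
  empty := by
    rw [Finset.coe_empty, Set.image_empty, Submodule.span_empty, finrank_bot]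
  singleton i := by
    rw [Finset.coe_singleton, Set.image_singleton, finrank_span_singleton (hv i)]
  mono h := Submodule.finrank_mono (Submodule.span_mono (Set.image_mono (Finset.coe_subset.2 h)))
  submod B C := by
    rw [← Submodule.finrank_sup_add_finrank_inf_eq (Submodule.span K (v '' B)),
      ← Submodule.span_union, ← Set.image_union, ← Finset.coe_union]
    refine Nat.add_le_add_left (Submodule.finrank_mono (le_inf ?_ ?_)) _
    · exact Submodule.span_mono (Set.image_mono (by simp))
    · exact Submodule.span_mono (Set.image_mono (by simp))

theorem vectorRank_eq {K V I : Type} [Field K] [AddCommGroup V] [Module K V]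
    [FiniteDimensional K V] [DecidableEq I] (v : I → V) (hv : ∀ i, v i ≠ 0) (B : Finset I) :
    Module.finrank K (Submodule.span K (Set.range fun i : B => v ↑i))
      = (vectorRank (K := K) v hv).r B := by
  have : (Set.range fun i : B => v ↑i) = v '' B := by
    ext
    simp
  rw [this]
  rfl

/-- **Rota's log-concavity conjecture for realizable arrangements (Huh, Huh–Katz).**
Let `𝒜 = (H i)` be a finite family of linear hyperplanes in `K^d`, `H i = ker (l i)` with
`l i ≠ 0`, and let `χ = Σ_{B} (-1)^|B| q^(d - r B)` be its characteristic polynomial, where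
`r B = dim span {l i : i ∈ B}`.  Writing `χ = Σ_i (-1)^i a_i q^(d-i)`, the coefficients `a_i`
are nonnegative and form a log-concave sequence: `a_{i-1}·a_{i+1} ≤ a_i²` for all `i ≥ 1`
(hence the sequence is unimodal). -/
theorem rota_log_concavity {K : Type} [Field K] {d : ℕ} {I : Type} [Fintype I]
    (l : I → ((Fin d → K) →ₗ[K] K)) (hl : ∀ i, l i ≠ 0)
    (χ : Polynomial ℤ)
    (hχ : χ = ∑ B : Finset I,
      (-1 : Polynomial ℤ) ^ B.card *
        (X : Polynomial ℤ) ^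
          (d - Module.finrank K ↥(Submodule.span K (Set.range fun i : B => l ↑i))))
    (a : ℕ → ℤ)
    (ha : ∀ i, a i = if i ≤ d then (-1) ^ i * χ.coeff (d - i) else 0) :
    (∀ i, 0 ≤ a i) ∧ ∀ i, 1 ≤ i → a (i - 1) * a (i + 1) ≤ a i ^ 2 := by
  classical
  set M := vectorRank (K := K) l hl with hM
  have hr : ∀ B, M.r B ≤ d := by
    intro B
    refine (Submodule.finrank_le _).trans_eq ?_
    rw [Subspace.dual_finrank_eq (K := K) (V := Fin d → K), Module.finrank_fin_fun]
  have haw : ∀ i, a i = M.whitney i := by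
    intro i
    rw [ha]
    split_ifs with hi
    · rw [hχ, Polynomial.finsetSum_coeff, RankFn.whitney, Finset.sum_filter]
      congr 1
      refine Finset.sum_congr rfl fun B _ => ?_
      have h1 : (-1 : Polynomial ℤ) ^ B.card = C ((-1) ^ B.card) := by simp
      rw [vectorRank_eq l hl, h1, Polynomial.coeff_C_mul, Polynomial.coeff_X_pow, mul_ite, mul_one,
        mul_zero]
      refine if_congr ?_ rfl rfl
      have := hr B
      rw [← hM]
      omega
    · refine (M.whitney_eq_zero fun B => ?_).symm
      have := hr B
      omega
  refine ⟨fun i => haw i ▸ M.whitney_nonneg i, fun i hi => ?_⟩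
  obtain ⟨j, rfl⟩ := Nat.exists_eq_add_of_le' hi
  rw [haw, haw, haw]
  exact M.whitney_log_concave j
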